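/- arXiv:math/0010054 — 3 statements merged into one kernel-verified Lean document; each statement's English description precedes it below -/
import Mathlib

section
/- For Ω ∈ Λ³V*, one has λ(Ω) ≠ 0 if and only if there exist decomposable 3-forms α, β ∈ Λ³V* with α ∧ β ≠ 0 and Ω = α + β. -/
open scoped TensorProduct

noncomputable section

/-- The wedge product of alternating forms valued in a commutative algebra,
obtained from `AlternatingMap.domCoprod` (the sum over shuffles, so that the
wedge of covectors is given by a determinant). -/
def wedge {R A M : Type*} [CommRing R] [CommRing A] [Algebra R A]
    [AddCommGroup M] [Module R M] {m n : ℕ}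
    (α : AlternatingMap R M A (Fin m)) (β : AlternatingMap R M A (Fin n)) :
    AlternatingMap R M A (Fin (m + n)) :=
  (LinearMap.mul' R A).compAlternatingMap
    ((α.domCoprod β).domDomCongr finSumFinEquiv)

/-- A linear map regarded as an alternating 1-form. -/
def oneForm {R A M : Type*} [CommRing R] [CommRing A] [Algebra R A]
    [AddCommGroup M] [Module R M] (ξ : M →ₗ[R] A) : AlternatingMap R M A (Fin 1) :=
  AlternatingMap.ofSubsingleton R M A 0 ξ

/-- A 3-form is decomposable if it is the wedge of three covectors. -/
def IsDecomposable {R A M : Type*} [CommRing R] [CommRing A] [Algebra R A]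
    [AddCommGroup M] [Module R M] (α : AlternatingMap R M A (Fin 3)) : Prop :=
  ∃ ξ₁ ξ₂ ξ₃ : M →ₗ[R] A,
    α = wedge (oneForm ξ₁) (wedge (oneForm ξ₂) (oneForm ξ₃))

open Equiv in
theorem wedge_eq_sum {V : Type*} [AddCommGroup V] [Module ℂ V] {m n : ℕ} {ι : Type*} [Fintype ι]
    (α : AlternatingMap ℂ V ℂ (Fin m)) (β : AlternatingMap ℂ V ℂ (Fin n))
    (τ : ι → Perm (Fin (m + n)))
    (hinj : ∀ i j, (∀ a, ∃ a', τ i (Fin.castAdd n a') = τ j (Fin.castAdd n a)) → i = j)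
    (hsurj : ∀ σ : Perm (Fin (m + n)), ∃ i, ∀ a, ∃ a', τ i (Fin.castAdd n a') = σ (Fin.castAdd n a))
    (v : Fin (m + n) → V) :
    wedge α β v = ∑ i, ((Perm.sign (τ i) : ℤ) : ℂ) *
      (α (fun a => v (τ i (Fin.castAdd n a))) * β (fun b => v (τ i (Fin.natAdd m b)))) := by
  let c : ι → Perm (Fin m ⊕ Fin n) := fun i => finSumFinEquiv.symm.permCongr (τ i)
  have hrel : ∀ σ σ' : Perm (Fin m ⊕ Fin n),
      ((Quotient.mk'' σ : Perm.ModSumCongr (Fin m) (Fin n)) = Quotient.mk'' σ') ↔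
      ∀ a, ∃ a', σ (Sum.inl a') = σ' (Sum.inl a) := by
    intro σ σ'
    rw [Quotient.eq'', QuotientGroup.leftRel_apply]
    constructor
    · rintro ⟨⟨sl, sr⟩, h⟩ a
      refine ⟨sl a, ?_⟩
      have := inv_mul_eq_iff_eq_mul.mp h.symm
      rw [this]; simp
    · intro h
      apply Perm.mem_sumCongrHom_range_of_perm_mapsTo_inl
      rintro _ ⟨a, rfl⟩
      obtain ⟨a', ha'⟩ := h a
      exact ⟨a', by simp [← ha']⟩
  have hbij : Function.Bijective
      (fun i => (Quotient.mk'' (c i) : Perm.ModSumCongr (Fin m) (Fin n))) := by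
    constructor
    · intro i j h
      apply hinj
      intro a
      obtain ⟨a', h⟩ := (hrel _ _).1 h a
      exact ⟨a', by simpa [c, Equiv.permCongr_apply] using h⟩
    · intro q
      induction q using Quotient.inductionOn' with | _ σ
      obtain ⟨i, hi⟩ := hsurj (finSumFinEquiv.permCongr σ)
      refine ⟨i, (hrel _ _).2 fun a => ?_⟩
      obtain ⟨a', h⟩ := hi a
      refine ⟨a', ?_⟩
      simp [c, Equiv.permCongr_apply, h]
  have : wedge α β v = ∑ q : Perm.ModSumCongr (Fin m) (Fin n),
      LinearMap.mul' ℂ ℂ (AlternatingMap.domCoprod.summand α β q (fun i => v (finSumFinEquiv i))) := by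
    rw [← map_sum]
    simp [wedge, AlternatingMap.domCoprod_apply, Function.comp_def]
  rw [this]
  symm
  refine Fintype.sum_bijective _ hbij _ _ fun i => ?_
  have e : AlternatingMap.domCoprod.summand α β (Quotient.mk'' (c i)) (fun i => v (finSumFinEquiv i))
      = Perm.sign (c i) • ((α fun a => v (finSumFinEquiv (c i (Sum.inl a)))) ⊗ₜ[ℂ]
        (β fun b => v (finSumFinEquiv (c i (Sum.inr b))))) := rfl
  rw [e, Units.smul_def, map_zsmul]
  simp [c, Equiv.permCongr_apply]

theorem wedge_one_one {V : Type*} [AddCommGroup V] [Module ℂ V]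
    (θ : V →ₗ[ℂ] ℂ) (β : AlternatingMap ℂ V ℂ (Fin 1)) (v : Fin 2 → V) :
    wedge (oneForm θ) β v = θ (v 0) * β ![v 1] - θ (v 1) * β ![v 0] := by
  rw [wedge_eq_sum (oneForm θ) β (fun i : Fin 2 => i.cycleRange.symm) (by
    intro i j h
    obtain ⟨a', h⟩ := h 0
    rw [Subsingleton.elim a' 0] at h
    exact (Fin.cycleRange_symm_zero i).symm.trans (h.trans (Fin.cycleRange_symm_zero j))) (by
    intro σ
    refine ⟨σ 0, fun a => ⟨0, ?_⟩⟩
    rw [Subsingleton.elim a 0]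
    exact Fin.cycleRange_symm_zero _)]
  have e : ∀ i : Fin 2, (fun b : Fin 1 => v (i.cycleRange.symm (Fin.natAdd 1 b)))
      = fun b => v (i.succAbove b) := fun i => funext fun b => congrArg v (by
    rw [← Fin.cycleRange_symm_succ]; congr 1; exact Fin.ext (Nat.add_comm _ _))
  have e0 : ∀ i : Fin 2, oneForm θ (fun b : Fin 1 => v (i.cycleRange.symm (Fin.castAdd 1 b)))
      = θ (v i) := fun i => congrArg (fun x => θ (v x)) (Fin.cycleRange_symm_zero i)
  have es : ∀ i : Fin 2, ((Equiv.Perm.sign i.cycleRange.symm : ℤ) : ℂ) = (-1) ^ (i : ℕ) := by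
    intro i
    rw [Equiv.Perm.sign_symm, Fin.sign_cycleRange]; simp
  simp only [e, e0, es]
  have h0 : (fun b : Fin 1 => v ((0 : Fin 2).succAbove b)) = ![v 1] := by
    ext b; fin_cases b <;> rfl
  have h1 : (fun b : Fin 1 => v ((1 : Fin 2).succAbove b)) = ![v 0] := by
    ext b; fin_cases b <;> rfl
  simp only [Fin.sum_univ_two, h0, h1]
  norm_num [show ((2 : Fin 6) : ℕ) = 2 from rfl, show ((3 : Fin 6) : ℕ) = 3 from rfl, show ((4 : Fin 6) : ℕ) = 4 from rfl, show ((5 : Fin 6) : ℕ) = 5 from rfl]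
  try ring

theorem wedge_one_two {V : Type*} [AddCommGroup V] [Module ℂ V]
    (θ : V →ₗ[ℂ] ℂ) (β : AlternatingMap ℂ V ℂ (Fin 2)) (v : Fin 3 → V) :
    wedge (oneForm θ) β v = θ (v 0) * β ![v 1, v 2] - θ (v 1) * β ![v 0, v 2] + θ (v 2) * β ![v 0, v 1] := by
  rw [wedge_eq_sum (oneForm θ) β (fun i : Fin 3 => i.cycleRange.symm) (by
    intro i j h
    obtain ⟨a', h⟩ := h 0
    rw [Subsingleton.elim a' 0] at h
    exact (Fin.cycleRange_symm_zero i).symm.trans (h.trans (Fin.cycleRange_symm_zero j))) (by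
    intro σ
    refine ⟨σ 0, fun a => ⟨0, ?_⟩⟩
    rw [Subsingleton.elim a 0]
    exact Fin.cycleRange_symm_zero _)]
  have e : ∀ i : Fin 3, (fun b : Fin 2 => v (i.cycleRange.symm (Fin.natAdd 1 b)))
      = fun b => v (i.succAbove b) := fun i => funext fun b => congrArg v (by
    rw [← Fin.cycleRange_symm_succ]; congr 1; exact Fin.ext (Nat.add_comm _ _))
  have e0 : ∀ i : Fin 3, oneForm θ (fun b : Fin 1 => v (i.cycleRange.symm (Fin.castAdd 2 b)))
      = θ (v i) := fun i => congrArg (fun x => θ (v x)) (Fin.cycleRange_symm_zero i)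
  have es : ∀ i : Fin 3, ((Equiv.Perm.sign i.cycleRange.symm : ℤ) : ℂ) = (-1) ^ (i : ℕ) := by
    intro i
    rw [Equiv.Perm.sign_symm, Fin.sign_cycleRange]; simp
  simp only [e, e0, es]
  have h0 : (fun b : Fin 2 => v ((0 : Fin 3).succAbove b)) = ![v 1, v 2] := by
    ext b; fin_cases b <;> rfl
  have h1 : (fun b : Fin 2 => v ((1 : Fin 3).succAbove b)) = ![v 0, v 2] := by
    ext b; fin_cases b <;> rfl
  have h2 : (fun b : Fin 2 => v ((2 : Fin 3).succAbove b)) = ![v 0, v 1] := by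
    ext b; fin_cases b <;> rfl
  simp only [Fin.sum_univ_three, h0, h1, h2]
  norm_num [show ((2 : Fin 6) : ℕ) = 2 from rfl, show ((3 : Fin 6) : ℕ) = 3 from rfl, show ((4 : Fin 6) : ℕ) = 4 from rfl, show ((5 : Fin 6) : ℕ) = 5 from rfl]
  try ring

theorem wedge_one_five {V : Type*} [AddCommGroup V] [Module ℂ V]
    (θ : V →ₗ[ℂ] ℂ) (β : AlternatingMap ℂ V ℂ (Fin 5)) (v : Fin 6 → V) :
    wedge (oneForm θ) β v = θ (v 0) * β ![v 1, v 2, v 3, v 4, v 5] - θ (v 1) * β ![v 0, v 2, v 3, v 4, v 5] + θ (v 2) * β ![v 0, v 1, v 3, v 4, v 5] - θ (v 3) * β ![v 0, v 1, v 2, v 4, v 5] + θ (v 4) * β ![v 0, v 1, v 2, v 3, v 5] - θ (v 5) * β ![v 0, v 1, v 2, v 3, v 4] := by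
  rw [wedge_eq_sum (oneForm θ) β (fun i : Fin 6 => i.cycleRange.symm) (by
    intro i j h
    obtain ⟨a', h⟩ := h 0
    rw [Subsingleton.elim a' 0] at h
    exact (Fin.cycleRange_symm_zero i).symm.trans (h.trans (Fin.cycleRange_symm_zero j))) (by
    intro σ
    refine ⟨σ 0, fun a => ⟨0, ?_⟩⟩
    rw [Subsingleton.elim a 0]
    exact Fin.cycleRange_symm_zero _)]
  have e : ∀ i : Fin 6, (fun b : Fin 5 => v (i.cycleRange.symm (Fin.natAdd 1 b)))
      = fun b => v (i.succAbove b) := fun i => funext fun b => congrArg v (by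
    rw [← Fin.cycleRange_symm_succ]; congr 1; exact Fin.ext (Nat.add_comm _ _))
  have e0 : ∀ i : Fin 6, oneForm θ (fun b : Fin 1 => v (i.cycleRange.symm (Fin.castAdd 5 b)))
      = θ (v i) := fun i => congrArg (fun x => θ (v x)) (Fin.cycleRange_symm_zero i)
  have es : ∀ i : Fin 6, ((Equiv.Perm.sign i.cycleRange.symm : ℤ) : ℂ) = (-1) ^ (i : ℕ) := by
    intro i
    rw [Equiv.Perm.sign_symm, Fin.sign_cycleRange]; simp
  simp only [e, e0, es]
  have h0 : (fun b : Fin 5 => v ((0 : Fin 6).succAbove b)) = ![v 1, v 2, v 3, v 4, v 5] := by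
    ext b; fin_cases b <;> rfl
  have h1 : (fun b : Fin 5 => v ((1 : Fin 6).succAbove b)) = ![v 0, v 2, v 3, v 4, v 5] := by
    ext b; fin_cases b <;> rfl
  have h2 : (fun b : Fin 5 => v ((2 : Fin 6).succAbove b)) = ![v 0, v 1, v 3, v 4, v 5] := by
    ext b; fin_cases b <;> rfl
  have h3 : (fun b : Fin 5 => v ((3 : Fin 6).succAbove b)) = ![v 0, v 1, v 2, v 4, v 5] := by
    ext b; fin_cases b <;> rfl
  have h4 : (fun b : Fin 5 => v ((4 : Fin 6).succAbove b)) = ![v 0, v 1, v 2, v 3, v 5] := by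
    ext b; fin_cases b <;> rfl
  have h5 : (fun b : Fin 5 => v ((5 : Fin 6).succAbove b)) = ![v 0, v 1, v 2, v 3, v 4] := by
    ext b; fin_cases b <;> rfl
  simp only [Fin.sum_univ_six, h0, h1, h2, h3, h4, h5]
  norm_num [show ((2 : Fin 6) : ℕ) = 2 from rfl, show ((3 : Fin 6) : ℕ) = 3 from rfl, show ((4 : Fin 6) : ℕ) = 4 from rfl, show ((5 : Fin 6) : ℕ) = 5 from rfl]
  try ring

/-- The ten (2,3)-shuffles. -/
def shuf (i : Fin 10) : Equiv.Perm (Fin 5) where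
  toFun := (![![0, 1, 2, 3, 4], ![0, 2, 1, 3, 4], ![0, 3, 1, 2, 4], ![0, 4, 1, 2, 3], ![1, 2, 0, 3, 4], ![1, 3, 0, 2, 4], ![1, 4, 0, 2, 3], ![2, 3, 0, 1, 4], ![2, 4, 0, 1, 3], ![3, 4, 0, 1, 2]] : Fin 10 → Fin 5 → Fin 5) i
  invFun := (![![0, 1, 2, 3, 4], ![0, 2, 1, 3, 4], ![0, 2, 3, 1, 4], ![0, 2, 3, 4, 1], ![2, 0, 1, 3, 4], ![2, 0, 3, 1, 4], ![2, 0, 3, 4, 1], ![2, 3, 0, 1, 4], ![2, 3, 0, 4, 1], ![2, 3, 4, 0, 1]] : Fin 10 → Fin 5 → Fin 5) i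
  left_inv := by revert i; decide
  right_inv := by revert i; decide

theorem wedge_two_three {V : Type*} [AddCommGroup V] [Module ℂ V]
    (α : AlternatingMap ℂ V ℂ (Fin 2)) (β : AlternatingMap ℂ V ℂ (Fin 3)) (v : Fin 5 → V) :
    wedge α β v = α ![v 0, v 1] * β ![v 2, v 3, v 4]
      - α ![v 0, v 2] * β ![v 1, v 3, v 4]
      + α ![v 0, v 3] * β ![v 1, v 2, v 4]
      - α ![v 0, v 4] * β ![v 1, v 2, v 3]
      + α ![v 1, v 2] * β ![v 0, v 3, v 4]
      - α ![v 1, v 3] * β ![v 0, v 2, v 4]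
      + α ![v 1, v 4] * β ![v 0, v 2, v 3]
      + α ![v 2, v 3] * β ![v 0, v 1, v 4]
      - α ![v 2, v 4] * β ![v 0, v 1, v 3]
      + α ![v 3, v 4] * β ![v 0, v 1, v 2] := by
  rw [wedge_eq_sum α β shuf (by decide) (by
    intro σ
    have key : ∀ x y : Fin 5, x ≠ y → ∃ i : Fin 10, (∃ a' : Fin 2, shuf i (Fin.castAdd 3 a') = x) ∧
      (∃ a' : Fin 2, shuf i (Fin.castAdd 3 a') = y) := by decide
    obtain ⟨i, h0, h1⟩ := key (σ 0) (σ 1) (by simp)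
    refine ⟨i, fun a => ?_⟩
    fin_cases a
    · exact h0
    · exact h1)]
  have a0 : (fun b : Fin 2 => v (shuf 0 (Fin.castAdd 3 b))) = ![v 0, v 1] := by
    ext b; fin_cases b <;> rfl
  have b0 : (fun b : Fin 3 => v (shuf 0 (Fin.natAdd 2 b))) = ![v 2, v 3, v 4] := by
    ext b; fin_cases b <;> rfl
  have s0 : Equiv.Perm.sign (shuf 0) = 1 := by decide
  have a1 : (fun b : Fin 2 => v (shuf 1 (Fin.castAdd 3 b))) = ![v 0, v 2] := by
    ext b; fin_cases b <;> rfl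
  have b1 : (fun b : Fin 3 => v (shuf 1 (Fin.natAdd 2 b))) = ![v 1, v 3, v 4] := by
    ext b; fin_cases b <;> rfl
  have s1 : Equiv.Perm.sign (shuf 1) = -1 := by decide
  have a2 : (fun b : Fin 2 => v (shuf 2 (Fin.castAdd 3 b))) = ![v 0, v 3] := by
    ext b; fin_cases b <;> rfl
  have b2 : (fun b : Fin 3 => v (shuf 2 (Fin.natAdd 2 b))) = ![v 1, v 2, v 4] := by
    ext b; fin_cases b <;> rfl
  have s2 : Equiv.Perm.sign (shuf 2) = 1 := by decide
  have a3 : (fun b : Fin 2 => v (shuf 3 (Fin.castAdd 3 b))) = ![v 0, v 4] := by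
    ext b; fin_cases b <;> rfl
  have b3 : (fun b : Fin 3 => v (shuf 3 (Fin.natAdd 2 b))) = ![v 1, v 2, v 3] := by
    ext b; fin_cases b <;> rfl
  have s3 : Equiv.Perm.sign (shuf 3) = -1 := by decide
  have a4 : (fun b : Fin 2 => v (shuf 4 (Fin.castAdd 3 b))) = ![v 1, v 2] := by
    ext b; fin_cases b <;> rfl
  have b4 : (fun b : Fin 3 => v (shuf 4 (Fin.natAdd 2 b))) = ![v 0, v 3, v 4] := by
    ext b; fin_cases b <;> rfl
  have s4 : Equiv.Perm.sign (shuf 4) = 1 := by decide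
  have a5 : (fun b : Fin 2 => v (shuf 5 (Fin.castAdd 3 b))) = ![v 1, v 3] := by
    ext b; fin_cases b <;> rfl
  have b5 : (fun b : Fin 3 => v (shuf 5 (Fin.natAdd 2 b))) = ![v 0, v 2, v 4] := by
    ext b; fin_cases b <;> rfl
  have s5 : Equiv.Perm.sign (shuf 5) = -1 := by decide
  have a6 : (fun b : Fin 2 => v (shuf 6 (Fin.castAdd 3 b))) = ![v 1, v 4] := by
    ext b; fin_cases b <;> rfl
  have b6 : (fun b : Fin 3 => v (shuf 6 (Fin.natAdd 2 b))) = ![v 0, v 2, v 3] := by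
    ext b; fin_cases b <;> rfl
  have s6 : Equiv.Perm.sign (shuf 6) = 1 := by decide
  have a7 : (fun b : Fin 2 => v (shuf 7 (Fin.castAdd 3 b))) = ![v 2, v 3] := by
    ext b; fin_cases b <;> rfl
  have b7 : (fun b : Fin 3 => v (shuf 7 (Fin.natAdd 2 b))) = ![v 0, v 1, v 4] := by
    ext b; fin_cases b <;> rfl
  have s7 : Equiv.Perm.sign (shuf 7) = 1 := by decide
  have a8 : (fun b : Fin 2 => v (shuf 8 (Fin.castAdd 3 b))) = ![v 2, v 4] := by
    ext b; fin_cases b <;> rfl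
  have b8 : (fun b : Fin 3 => v (shuf 8 (Fin.natAdd 2 b))) = ![v 0, v 1, v 3] := by
    ext b; fin_cases b <;> rfl
  have s8 : Equiv.Perm.sign (shuf 8) = -1 := by decide
  have a9 : (fun b : Fin 2 => v (shuf 9 (Fin.castAdd 3 b))) = ![v 3, v 4] := by
    ext b; fin_cases b <;> rfl
  have b9 : (fun b : Fin 3 => v (shuf 9 (Fin.natAdd 2 b))) = ![v 0, v 1, v 2] := by
    ext b; fin_cases b <;> rfl
  have s9 : Equiv.Perm.sign (shuf 9) = 1 := by decide
  have hs : ∀ f : Fin 10 → ℂ, ∑ i, f i = f 0 + (f 1 + (f 2 + (f 3 + (f 4 + (f 5 + (f 6 + (f 7 +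
      (f 8 + (f 9 + 0))))))))) := fun f => by
    simp only [Fin.sum_univ_succ, Fin.sum_univ_zero]; rfl
  simp only [hs, a0, b0, s0, a1, b1, s1, a2, b2, s2, a3, b3, s3, a4, b4, s4, a5, b5, s5, a6, b6, s6, a7, b7, s7, a8, b8, s8, a9, b9, s9]
  push_cast
  ring

/-- Expansion of the wedge of a 2-form and a 3-form on five basis vectors. -/
def wD (f : Fin 6 → Fin 6 → ℂ) (a : Fin 6 → Fin 6 → Fin 6 → ℂ) (p q r s t : Fin 6) : ℂ :=
  f p q * a r s t - f p r * a q s t + f p s * a q r t - f p t * a q r s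
    + f q r * a p s t - f q s * a p r t + f q t * a p r s
    + f r s * a p q t - f r t * a p q s + f s t * a p q r

/-- Expansion of the wedge of a 1-form, a 2-form and a 3-form on six basis vectors. -/
def wT (θ : Fin 6 → ℂ) (f : Fin 6 → Fin 6 → ℂ) (a : Fin 6 → Fin 6 → Fin 6 → ℂ) : ℂ :=
  θ 0 * wD f a 1 2 3 4 5 - θ 1 * wD f a 0 2 3 4 5 + θ 2 * wD f a 0 1 3 4 5
    - θ 3 * wD f a 0 1 2 4 5 + θ 4 * wD f a 0 1 2 3 5 - θ 5 * wD f a 0 1 2 3 4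

/-- An alternating three-index array. -/
def Alt3 (a : Fin 6 → Fin 6 → Fin 6 → ℂ) : Prop :=
  (∀ i j k, a i j k = - a j i k) ∧ (∀ i j k, a i j k = - a i k j)

theorem Alt3.rules {a : Fin 6 → Fin 6 → Fin 6 → ℂ} (h : Alt3 a) :
    (∀ i j k, j < i → a i j k = - a j i k) ∧ (∀ i j k, k < j → a i j k = - a i k j) ∧
    (∀ i k, a i i k = 0) ∧ (∀ i k, a i k k = 0) := by
  refine ⟨fun i j k _ => h.1 i j k, fun i j k _ => h.2 i j k, fun i k => ?_, fun i k => ?_⟩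
  · have := h.1 i i k; linear_combination this / 2
  · have := h.2 i k k; linear_combination this / 2

theorem poly1 {a : Fin 6 → Fin 6 → Fin 6 → ℂ} (h : Alt3 a) :
    wT (fun k => a k 0 1) (a 0) a = 0 := by
  obtain ⟨h1, h2, h3, h4⟩ := h.rules
  simp (decide := true) only [wT, wD, h1, h2, h3, h4]
  ring

theorem poly3 {a : Fin 6 → Fin 6 → Fin 6 → ℂ} (h : Alt3 a) :
    ∑ i, wT (Pi.single i 1) (a i) a = 0 := by
  obtain ⟨h1, h2, h3, h4⟩ := h.rules
  simp (decide := true) only [Fin.sum_univ_six, Pi.single_apply, if_true, if_false, wT, wD,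
    h1, h2, h3, h4]
  ring

theorem poly2 {a : Fin 6 → Fin 6 → Fin 6 → ℂ} (h : Alt3 a) :
    wT (Pi.single 1 1) (fun p q => wT (fun k => a k p q) (a 0) a) a = 0 := by
  obtain ⟨h1, h2, h3, h4⟩ := h.rules
  simp (decide := true) only [Pi.single_apply, if_true, if_false, wT, wD,
    h1, h2, h3, h4]
  ring

theorem alt_swap12 {V : Type*} [AddCommGroup V] [Module ℂ V] (Ω : AlternatingMap ℂ V ℂ (Fin 3))
    (x y z : V) : Ω ![x, y, z] = - Ω ![y, x, z] := by
  rw [← Ω.map_swap ![y, x, z] (i := 0) (j := 1) (by decide)]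
  congr 1; ext i; fin_cases i <;> rfl

theorem alt_swap23 {V : Type*} [AddCommGroup V] [Module ℂ V] (Ω : AlternatingMap ℂ V ℂ (Fin 3))
    (x y z : V) : Ω ![x, y, z] = - Ω ![x, z, y] := by
  rw [← Ω.map_swap ![x, z, y] (i := 1) (j := 2) (by decide)]
  congr 1; ext i; fin_cases i <;> rfl

theorem alt3_of {V : Type*} [AddCommGroup V] [Module ℂ V] (Ω : AlternatingMap ℂ V ℂ (Fin 3))
    (e : Fin 6 → V) : Alt3 (fun i j k => Ω ![e i, e j, e k]) :=
  ⟨fun _ _ _ => alt_swap12 _ _ _ _, fun _ _ _ => alt_swap23 _ _ _ _⟩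

/-- Contraction of a 3-form in its last two arguments. -/
def con {V : Type*} [AddCommGroup V] [Module ℂ V] (Ω : AlternatingMap ℂ V ℂ (Fin 3))
    (y z : V) : V →ₗ[ℂ] ℂ where
  toFun x := Ω ![x, y, z]
  map_add' x x' := by
    change Ω.curryLeft (x + x') ![y, z] = Ω.curryLeft x ![y, z] + Ω.curryLeft x' ![y, z]
    rw [map_add]; rfl
  map_smul' c x := by
    change Ω.curryLeft (c • x) ![y, z] = c • Ω.curryLeft x ![y, z]
    rw [map_smul]; rfl

/-- The defining property of the endomorphism attached to a 3-form. -/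
def IsK {V : Type*} [AddCommGroup V] [Module ℂ V] (ε : AlternatingMap ℂ V ℂ (Fin 6))
    (Ω : AlternatingMap ℂ V ℂ (Fin 3)) (k : V →ₗ[ℂ] V) : Prop :=
  ∀ (θ : V →ₗ[ℂ] ℂ) (v : V), wedge (oneForm θ) (wedge (Ω.curryLeft v) Ω) = θ (k v) • ε

set_option maxRecDepth 20000 in
theorem IsK.form {V : Type*} [AddCommGroup V] [Module ℂ V] {ε : AlternatingMap ℂ V ℂ (Fin 6)}
    {Ω : AlternatingMap ℂ V ℂ (Fin 3)} {k : V →ₗ[ℂ] V} (h : IsK ε Ω k)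
    (θ : V →ₗ[ℂ] ℂ) (u : V) (e : Fin 6 → V) :
    θ (k u) * ε e = wT (fun i => θ (e i)) (fun p q => Ω ![u, e p, e q])
      (fun i j k => Ω ![e i, e j, e k]) := by
  have h1 := h θ u
  have h2 := wedge_one_five θ (wedge (Ω.curryLeft u) Ω) e
  have h3 : θ (k u) * ε e = (θ (k u) • ε) e := rfl
  rw [h3, ← h1]
  refine h2.trans ?_
  have h4 : ∀ p q r s t : Fin 6, wedge (Ω.curryLeft u) Ω ![e p, e q, e r, e s, e t] =
      wD (fun p q => Ω ![u, e p, e q]) (fun i j k => Ω ![e i, e j, e k]) p q r s t :=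
    fun p q r s t => wedge_two_three (Ω.curryLeft u) Ω ![e p, e q, e r, e s, e t]
  unfold wT
  rw [← h4, ← h4, ← h4, ← h4, ← h4, ← h4]

theorem exists_basis_pair {V : Type*} [AddCommGroup V] [Module ℂ V] [FiniteDimensional ℂ V]
    (hdim : Module.finrank ℂ V = 6) {u w : V} (h : LinearIndependent ℂ ![u, w]) :
    ∃ b : Module.Basis (Fin 6) ℂ V, b 0 = u ∧ b 1 = w := by
  obtain ⟨x2, h2⟩ := exists_linearIndependent_snoc_of_lt_finrank h (by omega)
  obtain ⟨x3, h3⟩ := exists_linearIndependent_snoc_of_lt_finrank h2 (by omega)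
  obtain ⟨x4, h4⟩ := exists_linearIndependent_snoc_of_lt_finrank h3 (by omega)
  obtain ⟨x5, h5⟩ := exists_linearIndependent_snoc_of_lt_finrank h4 (by omega)
  refine ⟨basisOfLinearIndependentOfCardEqFinrank h5 (by simp [hdim]), ?_, ?_⟩
  · rw [coe_basisOfLinearIndependentOfCardEqFinrank]; rfl
  · rw [coe_basisOfLinearIndependentOfCardEqFinrank]; rfl

theorem exists_basis_single {V : Type*} [AddCommGroup V] [Module ℂ V] [FiniteDimensional ℂ V]
    (hdim : Module.finrank ℂ V = 6) {u : V} (h : u ≠ 0) :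
    ∃ b : Module.Basis (Fin 6) ℂ V, b 0 = u := by
  obtain ⟨w, hw⟩ := exists_linearIndependent_pair_of_one_lt_finrank (R := ℂ) (M := V) (by omega) h
  obtain ⟨b, hb, -⟩ := exists_basis_pair hdim hw
  exact ⟨b, hb⟩

section
variable {V : Type*} [AddCommGroup V] [Module ℂ V] [FiniteDimensional ℂ V]
    {ε : AlternatingMap ℂ V ℂ (Fin 6)}
    {Ω : AlternatingMap ℂ V ℂ (Fin 3)} {k : V →ₗ[ℂ] V}

theorem eps_ne (hε : ε ≠ 0) (b : Module.Basis (Fin 6) ℂ V) : ε b ≠ 0 := by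
  rwa [Ne, AlternatingMap.map_basis_eq_zero_iff]

theorem IsK.self (hdim : Module.finrank ℂ V = 6) (hε : ε ≠ 0) (h : IsK ε Ω k) (u w : V) :
    Ω ![k u, u, w] = 0 := by
  by_cases hl : LinearIndependent ℂ ![u, w]
  · obtain ⟨b, rfl, rfl⟩ := exists_basis_pair hdim hl
    have h1 := h.form (con Ω (b 0) (b 1)) (b 0) b
    have h2 := poly1 (alt3_of Ω b)
    have h3 : Ω ![k (b 0), b 0, b 1] * ε b = 0 := h1.trans h2
    exact (mul_eq_zero.1 h3).resolve_right (eps_ne hε b)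
  · by_cases hu : u = 0
    · subst hu
      exact Ω.map_coord_zero (i := 1) rfl
    · rw [LinearIndependent.pair_iff' hu] at hl
      push Not at hl
      obtain ⟨c, rfl⟩ := hl
      have : Ω ![k u, u, c • u] = - (c • Ω ![u, u, k u]) := by
        rw [alt_swap12, alt_swap23, alt_swap12]
        have := (con Ω u (k u)).map_smul c u
        rw [neg_neg]
        exact congrArg Neg.neg this
      rw [this, Ω.map_eq_zero_of_eq ![u, u, k u] (i := 0) (j := 1) rfl (by decide)]
      simp

theorem IsK.comm (hdim : Module.finrank ℂ V = 6) (hε : ε ≠ 0) (h : IsK ε Ω k) (u v w : V) :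
    Ω ![k u, v, w] = Ω ![u, k v, w] := by
  have h1 := h.self hdim hε (u + v) w
  have h2 := h.self hdim hε u w
  have h3 := h.self hdim hε v w
  have e1 : Ω ![k (u + v), u + v, w] = Ω ![k u, u, w] + Ω ![k u, v, w] + Ω ![k v, u, w] +
      Ω ![k v, v, w] := by
    have a1 : ∀ x, Ω ![k (u + v), x, w] = Ω ![k u, x, w] + Ω ![k v, x, w] := fun x => by
      rw [map_add]; exact (con Ω x w).map_add _ _
    have a2 : ∀ x, Ω ![x, u + v, w] = Ω ![x, u, w] + Ω ![x, v, w] := fun x => by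
      rw [alt_swap12 Ω x, alt_swap12 Ω x, alt_swap12 Ω x v, ← neg_add]
      exact congrArg Neg.neg ((con Ω x w).map_add _ _)
    rw [a1, a2, a2]; ring
  rw [alt_swap12 Ω u]
  linear_combination h1 - h2 - h3 - e1

theorem IsK.sq (hdim : Module.finrank ℂ V = 6) (hε : ε ≠ 0) (h : IsK ε Ω k) :
    ∃ c : ℂ, k ∘ₗ k = c • 1 := by
  apply LinearMap.exists_eq_smul_id_of_forall_notLinearIndependent
  intro u hl
  obtain ⟨b, rfl, hb⟩ := exists_basis_pair hdim hl
  have hθ : (fun i => b.coord 1 (b i)) = Pi.single 1 1 := by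
    ext i; simp [Module.Basis.coord_apply, Finsupp.single_apply, Pi.single_apply, eq_comm]
  have h1 := h.form (b.coord 1) (k (b 0)) b
  have h2 := fun p q => h.form (con Ω (b p) (b q)) (b 0) b
  have h3 := poly2 (alt3_of Ω b)
  rw [hθ] at h1
  have h4 : wT (Pi.single 1 1) (fun p q => Ω ![k (b 0), b p, b q] * ε b)
      (fun i j k => Ω ![b i, b j, b k]) = 0 := by
    rw [← h3]
    congr 1
    ext p q
    exact h2 p q
  have h5 : wT (Pi.single 1 1) (fun p q => Ω ![k (b 0), b p, b q] * ε b)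
      (fun i j k => Ω ![b i, b j, b k]) = wT (Pi.single 1 1) (fun p q => Ω ![k (b 0), b p, b q])
      (fun i j k => Ω ![b i, b j, b k]) * ε b := by
    simp only [wT, wD]; ring
  have h6 : b.coord 1 (k (k (b 0))) = 1 := by
    change b.coord 1 ((k ∘ₗ k) (b 0)) = 1
    rw [← hb]; simp
  rw [h5, ← h1, h6] at h4
  have := eps_ne hε b
  simp_all

theorem IsK.trace (hdim : Module.finrank ℂ V = 6) (hε : ε ≠ 0) (h : IsK ε Ω k) :
    LinearMap.trace ℂ V k = 0 := by
  let b : Module.Basis (Fin 6) ℂ V := Module.finBasisOfFinrankEq ℂ V hdim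
  have h1 := fun i => h.form (b.coord i) (b i) b
  have hθ : ∀ j, (fun i => b.coord j (b i)) = Pi.single j 1 := by
    intro j
    ext i; simp [Module.Basis.coord_apply, Finsupp.single_apply, Pi.single_apply, eq_comm]
  simp only [hθ] at h1
  have h2 := poly3 (alt3_of Ω b)
  have h3 : LinearMap.trace ℂ V k = ∑ i, b.coord i (k (b i)) := by
    rw [LinearMap.trace_eq_matrix_trace ℂ b, Matrix.trace]
    simp [LinearMap.toMatrix_apply]
  have h4 : LinearMap.trace ℂ V k * ε b = 0 := by
    rw [h3, Finset.sum_mul, ← h2]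
    exact Finset.sum_congr rfl fun i _ => h1 i
  exact (mul_eq_zero.1 h4).resolve_right (eps_ne hε b)

end
/-- The twenty (3,3)-shuffles. -/
def shuff (i : Fin 20) : Equiv.Perm (Fin 6) where
  toFun := (![![0, 1, 2, 3, 4, 5], ![0, 1, 3, 2, 4, 5], ![0, 1, 4, 2, 3, 5], ![0, 1, 5, 2, 3, 4], ![0, 2, 3, 1, 4, 5], ![0, 2, 4, 1, 3, 5], ![0, 2, 5, 1, 3, 4], ![0, 3, 4, 1, 2, 5], ![0, 3, 5, 1, 2, 4], ![0, 4, 5, 1, 2, 3], ![1, 2, 3, 0, 4, 5], ![1, 2, 4, 0, 3, 5], ![1, 2, 5, 0, 3, 4], ![1, 3, 4, 0, 2, 5], ![1, 3, 5, 0, 2, 4], ![1, 4, 5, 0, 2, 3], ![2, 3, 4, 0, 1, 5], ![2, 3, 5, 0, 1, 4], ![2, 4, 5, 0, 1, 3], ![3, 4, 5, 0, 1, 2]] : Fin 20 → Fin 6 → Fin 6) i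
  invFun := (![![0, 1, 2, 3, 4, 5], ![0, 1, 3, 2, 4, 5], ![0, 1, 3, 4, 2, 5], ![0, 1, 3, 4, 5, 2], ![0, 3, 1, 2, 4, 5], ![0, 3, 1, 4, 2, 5], ![0, 3, 1, 4, 5, 2], ![0, 3, 4, 1, 2, 5], ![0, 3, 4, 1, 5, 2], ![0, 3, 4, 5, 1, 2], ![3, 0, 1, 2, 4, 5], ![3, 0, 1, 4, 2, 5], ![3, 0, 1, 4, 5, 2], ![3, 0, 4, 1, 2, 5], ![3, 0, 4, 1, 5, 2], ![3, 0, 4, 5, 1, 2], ![3, 4, 0, 1, 2, 5], ![3, 4, 0, 1, 5, 2], ![3, 4, 0, 5, 1, 2], ![3, 4, 5, 0, 1, 2]] : Fin 20 → Fin 6 → Fin 6) i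
  left_inv := by revert i; decide
  right_inv := by revert i; decide

theorem shuff_key : ∀ x y z : Fin 6, x ≠ y → x ≠ z → y ≠ z →
    ∃ i : Fin 20, (∃ a' : Fin 3, shuff i (Fin.castAdd 3 a') = x) ∧
      (∃ a' : Fin 3, shuff i (Fin.castAdd 3 a') = y) ∧
      (∃ a' : Fin 3, shuff i (Fin.castAdd 3 a') = z) := by decide +kernel

theorem wedge_three_three {V : Type*} [AddCommGroup V] [Module ℂ V]
    (α : AlternatingMap ℂ V ℂ (Fin 3)) (β : AlternatingMap ℂ V ℂ (Fin 3)) (v : Fin 6 → V) :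
    wedge α β v = ∑ i, ((Equiv.Perm.sign (shuff i) : ℤ) : ℂ) *
      (α ![v (shuff i 0), v (shuff i 1), v (shuff i 2)] *
       β ![v (shuff i 3), v (shuff i 4), v (shuff i 5)]) := by
  rw [wedge_eq_sum α β shuff (by decide +kernel) (by
    intro σ
    obtain ⟨i, h0, h1, h2⟩ := shuff_key (σ 0) (σ 1) (σ 2) (by simp) (by simp) (by simp)
    refine ⟨i, fun a => ?_⟩
    fin_cases a
    · exact h0
    · exact h1
    · exact h2)]
  refine Finset.sum_congr rfl fun i _ => ?_
  congr 2
  · congr 1; ext b; fin_cases b <;> rfl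
  · congr 1; ext b; fin_cases b <;> rfl

set_option maxRecDepth 20000 in
/-- If both forms vanish as soon as one argument is `x`, so does their wedge. -/
theorem wedge_eq_zero_of {V : Type*} [AddCommGroup V] [Module ℂ V] [FiniteDimensional ℂ V]
    (hdim : Module.finrank ℂ V = 6)
    (α β : AlternatingMap ℂ V ℂ (Fin 3)) (x : V) (hx : x ≠ 0) (hα : ∀ y z, α ![x, y, z] = 0)
    (hβ : ∀ y z, β ![x, y, z] = 0) : wedge α β = 0 := by
  obtain ⟨b, hb⟩ := exists_basis_single hdim hx
  have hα' : ∀ y z, α ![y, x, z] = 0 := fun y z => by rw [alt_swap12, hα, neg_zero]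
  have hβ' : ∀ y z, β ![y, x, z] = 0 := fun y z => by rw [alt_swap12, hβ, neg_zero]
  have hα2 : ∀ y z, α ![y, z, x] = 0 := fun y z => by rw [alt_swap23, hα', neg_zero]
  have hβ2 : ∀ y z, β ![y, z, x] = 0 := fun y z => by rw [alt_swap23, hβ', neg_zero]
  have h0 : wedge α β b = 0 := by
    rw [wedge_three_three]
    refine Finset.sum_eq_zero fun i _ => ?_
    have key : ∀ i : Fin 20, shuff i 0 = 0 ∨ shuff i 1 = 0 ∨ shuff i 2 = 0 ∨ shuff i 3 = 0 ∨
      shuff i 4 = 0 ∨ shuff i 5 = 0 := by decide +kernel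
    rcases key i with h | h | h | h | h | h <;> rw [h, hb] <;> simp only [hα, hα', hα2, hβ, hβ', hβ2, mul_zero, zero_mul]
  exact (AlternatingMap.map_basis_eq_zero_iff b _).1 h0

theorem wedge_split {V : Type*} [AddCommGroup V] [Module ℂ V]
    (α β : AlternatingMap ℂ V ℂ (Fin 3)) (e : Fin 6 → V)
    (hα : ∀ i : Fin 6, 3 ≤ i → ∀ y z, α ![y, z, e i] = 0) :
    wedge α β e = α ![e 0, e 1, e 2] * β ![e 3, e 4, e 5] := by
  rw [wedge_three_three, Finset.sum_eq_single 0]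
  · have : Equiv.Perm.sign (shuff 0) = 1 := by decide
    rw [this]
    simp [shuff]
  · intro i _ hi
    have key : ∀ i : Fin 20, i ≠ 0 → 3 ≤ shuff i 2 := by decide +kernel
    rw [hα _ (key i hi)]; simp
  · simp

theorem decomp_apply {V : Type*} [AddCommGroup V] [Module ℂ V] (ξ₁ ξ₂ ξ₃ : V →ₗ[ℂ] ℂ)
    (v : Fin 3 → V) :
    wedge (oneForm ξ₁) (wedge (oneForm ξ₂) (oneForm ξ₃)) v =
      ξ₁ (v 0) * (ξ₂ (v 1) * ξ₃ (v 2) - ξ₂ (v 2) * ξ₃ (v 1))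
      - ξ₁ (v 1) * (ξ₂ (v 0) * ξ₃ (v 2) - ξ₂ (v 2) * ξ₃ (v 0))
      + ξ₁ (v 2) * (ξ₂ (v 0) * ξ₃ (v 1) - ξ₂ (v 1) * ξ₃ (v 0)) := by
  refine (wedge_one_two ξ₁ (wedge (oneForm ξ₂) (oneForm ξ₃)) v).trans ?_
  have h4 : ∀ x y : V, wedge (oneForm ξ₂) (oneForm ξ₃) ![x, y] = ξ₂ x * ξ₃ y - ξ₂ y * ξ₃ x :=
    fun x y => wedge_one_one ξ₂ (oneForm ξ₃) ![x, y]
  rw [← h4, ← h4, ← h4]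

section
variable {V : Type*} [AddCommGroup V] [Module ℂ V] [FiniteDimensional ℂ V]
    {ε : AlternatingMap ℂ V ℂ (Fin 6)}
    {Ω : AlternatingMap ℂ V ℂ (Fin 3)} {k : V →ₗ[ℂ] V}

theorem trace_ne_of_decomp (hdim : Module.finrank ℂ V = 6) (hε : ε ≠ 0) (h : IsK ε Ω k)
    (α β : AlternatingMap ℂ V ℂ (Fin 3)) (hα : IsDecomposable α) (hβ : IsDecomposable β)
    (hw : wedge α β ≠ 0) (hΩ : Ω = α + β) : LinearMap.trace ℂ V (k ∘ₗ k) ≠ 0 := by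
  obtain ⟨ξ₁, ξ₂, ξ₃, rfl⟩ := hα
  obtain ⟨η₁, η₂, η₃, rfl⟩ := hβ
  let L : V →ₗ[ℂ] (Fin 6 → ℂ) := LinearMap.pi ![ξ₁, ξ₂, ξ₃, η₁, η₂, η₃]
  have hinj : Function.Injective L := by
    rw [injective_iff_map_eq_zero]
    intro x hx
    by_contra hx0
    apply hw
    have e0 : ξ₁ x = 0 := congrFun hx 0
    have e1 : ξ₂ x = 0 := congrFun hx 1
    have e2 : ξ₃ x = 0 := congrFun hx 2
    have e3 : η₁ x = 0 := congrFun hx 3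
    have e4 : η₂ x = 0 := congrFun hx 4
    have e5 : η₃ x = 0 := congrFun hx 5
    refine wedge_eq_zero_of hdim _ _ x hx0 (fun y z => ?_) (fun y z => ?_)
    · refine (decomp_apply ξ₁ ξ₂ ξ₃ ![x, y, z]).trans ?_
      simp [e0, e1, e2]
    · refine (decomp_apply η₁ η₂ η₃ ![x, y, z]).trans ?_
      simp [e3, e4, e5]
  let E : V ≃ₗ[ℂ] (Fin 6 → ℂ) := LinearMap.linearEquivOfInjective L hinj (by simp [hdim])
  let b : Module.Basis (Fin 6) ℂ V := Module.Basis.ofEquivFun E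
  have hL : ∀ i j, L (b i) j = (Pi.single i 1 : Fin 6 → ℂ) j := by
    intro i j
    have : E (b i) = Pi.single i 1 := by simp [b]
    rw [← this]; rfl
  have e0 : ∀ i, ξ₁ (b i) = (Pi.single i 1 : Fin 6 → ℂ) 0 := fun i => hL i 0
  have e1 : ∀ i, ξ₂ (b i) = (Pi.single i 1 : Fin 6 → ℂ) 1 := fun i => hL i 1
  have e2 : ∀ i, ξ₃ (b i) = (Pi.single i 1 : Fin 6 → ℂ) 2 := fun i => hL i 2
  have e3 : ∀ i, η₁ (b i) = (Pi.single i 1 : Fin 6 → ℂ) 3 := fun i => hL i 3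
  have e4 : ∀ i, η₂ (b i) = (Pi.single i 1 : Fin 6 → ℂ) 4 := fun i => hL i 4
  have e5 : ∀ i, η₃ (b i) = (Pi.single i 1 : Fin 6 → ℂ) 5 := fun i => hL i 5
  have hf : ∀ u v w, Ω ![u, v, w] =
      (ξ₁ u * (ξ₂ v * ξ₃ w - ξ₂ w * ξ₃ v)
      - ξ₁ v * (ξ₂ u * ξ₃ w - ξ₂ w * ξ₃ u)
      + ξ₁ w * (ξ₂ u * ξ₃ v - ξ₂ v * ξ₃ u)) +
      (η₁ u * (η₂ v * η₃ w - η₂ w * η₃ v)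
      - η₁ v * (η₂ u * η₃ w - η₂ w * η₃ u)
      + η₁ w * (η₂ u * η₃ v - η₂ v * η₃ u)) := by
    intro u v w
    rw [hΩ]
    exact congrArg₂ (· + ·) (decomp_apply ξ₁ ξ₂ ξ₃ ![u, v, w]) (decomp_apply η₁ η₂ η₃ ![u, v, w])
  have key : ∀ u, ξ₁ (k u) * ε b = ξ₁ u := by
    intro u
    rw [h.form ξ₁ u b]
    simp (decide := true) [wT, wD, hf, e0, e1, e2, e3, e4, e5, Pi.single_apply]
  obtain ⟨c, hc⟩ := h.sq hdim hε
  have h1 := key (k (b 0))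
  have h2 := key (b 0)
  have h3 : k (k (b 0)) = c • b 0 := by
    have := LinearMap.congr_fun hc (b 0)
    simpa using this
  have h4 : ξ₁ (b 0) = 1 := by simp [e0]
  rw [h3, map_smul, h4] at h1
  rw [h4] at h2
  rw [hc]
  simp only [map_smul, LinearMap.trace_one, hdim]
  intro h0
  have hc0 : c = 0 := by simpa using h0
  rw [hc0] at h1
  rw [← h1] at h2
  simp at h2

theorem decomp_of_proj (Ω : AlternatingMap ℂ V ℂ (Fin 3)) (P : V →ₗ[ℂ] V)
    (hP : IsIdempotentElem P) (f : Module.Basis (Fin 3) ℂ (LinearMap.range P)) :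
    IsDecomposable (Ω.compLinearMap P) ∧
    (Ω.compLinearMap P ![(f 0 : V), f 1, f 2] = 0 → Ω.compLinearMap P = 0) := by
  let ω : AlternatingMap ℂ (LinearMap.range P) ℂ (Fin 3) :=
    Ω.compLinearMap (LinearMap.range P).subtype
  have hω : ω = ω f • f.det := AlternatingMap.eq_smul_basis_det f ω
  have hα : ∀ v, Ω.compLinearMap P v = ω f * f.det (fun i => P.rangeRestrict (v i)) := by
    intro v
    have : Ω.compLinearMap P v = ω (fun i => P.rangeRestrict (v i)) := rfl
    rw [this]
    conv_lhs => rw [hω]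
    rfl
  constructor
  · refine ⟨ω f • (f.coord 0 ∘ₗ P.rangeRestrict), f.coord 1 ∘ₗ P.rangeRestrict,
      f.coord 2 ∘ₗ P.rangeRestrict, ?_⟩
    ext v
    rw [hα]
    refine Eq.trans ?_ (decomp_apply _ _ _ v).symm
    rw [Module.Basis.det_apply, Matrix.det_fin_three]
    simp only [Module.Basis.toMatrix_apply, LinearMap.smul_apply, LinearMap.comp_apply,
      Module.Basis.coord_apply, smul_eq_mul]
    ring
  · intro h0
    have hfix : ∀ x : LinearMap.range P, P.rangeRestrict x = x := by
      rintro ⟨_, y, rfl⟩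
      apply Subtype.ext
      exact LinearMap.congr_fun hP y
    have : (fun i => P.rangeRestrict (![(f 0 : V), f 1, f 2] i)) = f := by
      ext i; fin_cases i <;> simp [hfix]
    rw [hα, this, Module.Basis.det_self, mul_one] at h0
    ext v
    rw [hα, h0, zero_mul]; rfl

theorem IsK.mixed (hdim : Module.finrank ℂ V = 6) (hε : ε ≠ 0) (h : IsK ε Ω k) {μ : ℂ}
    (hμ : μ ≠ 0) {x y : V} (hx : k x = μ • x) (hy : k y = -μ • y) (z : V) :
    Ω ![x, y, z] = 0 := by
  have h1 := h.comm hdim hε x y z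
  rw [hx, hy] at h1
  have h2 : Ω ![μ • x, y, z] = μ * Ω ![x, y, z] := (con Ω y z).map_smul μ x
  have h3 : Ω ![x, -μ • y, z] = -μ * Ω ![x, y, z] := by
    rw [alt_swap12 Ω x, alt_swap12 Ω x]
    have : Ω ![-μ • y, x, z] = -μ * Ω ![y, x, z] := (con Ω x z).map_smul (-μ) y
    rw [this]; ring
  rw [h2, h3] at h1
  have : (2 * μ) * Ω ![x, y, z] = 0 := by linear_combination h1
  exact (mul_eq_zero.1 this).resolve_left (by simp [hμ])

/-- A nonzero eigenvector cannot be annihilated by the 3-form. -/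
theorem IsK.nondeg (hdim : Module.finrank ℂ V = 6) (hε : ε ≠ 0) (h : IsK ε Ω k) {μ : ℂ}
    (hμ : μ ≠ 0) {x : V} (hx : k x = μ • x) (h0 : ∀ y z, Ω ![x, y, z] = 0) : x = 0 := by
  let b : Module.Basis (Fin 6) ℂ V := Module.finBasisOfFinrankEq ℂ V hdim
  have h1 : ∀ θ : V →ₗ[ℂ] ℂ, θ (k x) = 0 := by
    intro θ
    have := h.form θ x b
    simp only [h0, wT, wD, zero_mul, sub_zero, add_zero, mul_zero] at this
    exact (mul_eq_zero.1 this).resolve_right (eps_ne hε b)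
  have h2 : k x = 0 := (Module.forall_dual_apply_eq_zero_iff ℂ _).1 h1
  rw [hx] at h2
  exact (smul_eq_zero.1 h2).resolve_left hμ

theorem decomp_of_trace_ne (hdim : Module.finrank ℂ V = 6) (hε : ε ≠ 0) (h : IsK ε Ω k)
    (ht : LinearMap.trace ℂ V (k ∘ₗ k) ≠ 0) :
    ∃ α β : AlternatingMap ℂ V ℂ (Fin 3),
        IsDecomposable α ∧ IsDecomposable β ∧ wedge α β ≠ 0 ∧ Ω = α + β := by
  obtain ⟨c, hc⟩ := h.sq hdim hε
  have hc0 : c ≠ 0 := by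
    rintro rfl
    apply ht
    rw [hc]; simp
  obtain ⟨μ, rfl⟩ := IsAlgClosed.exists_eq_mul_self c
  have hμ : μ ≠ 0 := by rintro rfl; simp at hc0
  have hkk : ∀ x, k (k x) = (μ * μ) • x := fun x => by
    have := LinearMap.congr_fun hc x
    simpa using this
  let R : ℂ → V →ₗ[ℂ] V := fun ν => (2 : ℂ)⁻¹ • (1 + ν⁻¹ • k)
  have hR : ∀ ν, ν ≠ 0 → ν * ν = μ * μ → ∀ x, k (R ν x) = ν • R ν x := by
    intro ν hν hνμ x
    simp only [R, LinearMap.smul_apply, LinearMap.add_apply, Module.End.one_apply, map_smul,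
      map_add, hkk, ← hνμ]
    match_scalars <;> field_simp
  have hRid : ∀ ν, ν ≠ 0 → ∀ x, k x = ν • x → R ν x = x := by
    intro ν hν x hx
    simp only [R, LinearMap.smul_apply, LinearMap.add_apply, Module.End.one_apply, hx, smul_smul,
      inv_mul_cancel₀ hν]
    module
  have hRidem : ∀ ν, ν ≠ 0 → ν * ν = μ * μ → IsIdempotentElem (R ν) := by
    intro ν hν hνμ
    ext x
    exact hRid ν hν _ (hR ν hν hνμ x)
  have hRdim : ∀ ν, ν ≠ 0 → ν * ν = μ * μ → Module.finrank ℂ (LinearMap.range (R ν)) = 3 := by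
    intro ν hν hνμ
    have h1 := LinearMap.IsProj.trace (LinearMap.IsIdempotentElem.isProj_range _ (hRidem ν hν hνμ))
    have h2 : LinearMap.trace ℂ V (R ν) = 3 := by
      simp only [R, map_smul, map_add, LinearMap.trace_one, hdim, h.trace hdim hε]
      norm_num
    rw [h2] at h1
    exact_mod_cast h1.symm
  have hν : -μ ≠ 0 := neg_ne_zero.2 hμ
  have hνμ : -μ * -μ = μ * μ := by ring
  let f := Module.finBasisOfFinrankEq ℂ _ (hRdim μ hμ rfl)
  let g := Module.finBasisOfFinrankEq ℂ _ (hRdim (-μ) hν hνμ)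
  have hsum : ∀ x, x = R μ x + R (-μ) x := by
    intro x
    simp only [R, LinearMap.smul_apply, LinearMap.add_apply, Module.End.one_apply, inv_neg]
    module
  have hpm := fun x y z => h.mixed hdim hε hμ (hR μ hμ rfl x) (hR (-μ) hν hνμ y) z
  have hfk : ∀ i, k (f i) = μ • (f i : V) := by
    intro i
    obtain ⟨y, hy⟩ := (f i).2
    rw [← hy]; exact hR μ hμ rfl y
  have hgk : ∀ i, k (g i) = (-μ) • (g i : V) := by
    intro i
    obtain ⟨y, hy⟩ := (g i).2
    rw [← hy]; exact hR (-μ) hν hνμ y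
  have hgP : ∀ i, R μ (g i) = 0 := by
    intro i
    have := hsum (g i)
    rw [hRid (-μ) hν _ (hgk i)] at this
    simpa using this
  obtain ⟨hα, hα0⟩ := decomp_of_proj Ω (R μ) (hRidem μ hμ rfl) f
  obtain ⟨hβ, hβ0⟩ := decomp_of_proj Ω (R (-μ)) (hRidem (-μ) hν hνμ) g
  have hΩ : Ω = Ω.compLinearMap (R μ) + Ω.compLinearMap (R (-μ)) := by
    ext v
    have hv : v = ![v 0, v 1, v 2] := by ext i; fin_cases i <;> rfl
    have c1 : ∀ P : V →ₗ[ℂ] V, Ω.compLinearMap P v = Ω ![P (v 0), P (v 1), P (v 2)] := by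
      intro P
      change Ω _ = _
      congr 1; ext i; fin_cases i <;> rfl
    rw [AlternatingMap.add_apply, c1, c1]
    conv_lhs => rw [hv]
    generalize v 0 = x, v 1 = y, v 2 = z
    have a1 : ∀ p q y z, Ω ![p + q, y, z] = Ω ![p, y, z] + Ω ![q, y, z] := fun p q y z =>
      (con Ω y z).map_add p q
    have a2 : ∀ p q y z, Ω ![y, p + q, z] = Ω ![y, p, z] + Ω ![y, q, z] := fun p q y z => by
      rw [alt_swap12 Ω y, alt_swap12 Ω y p, alt_swap12 Ω y q, a1]; ring
    have a3 : ∀ p q y z, Ω ![y, z, p + q] = Ω ![y, z, p] + Ω ![y, z, q] := fun p q y z => by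
      rw [alt_swap23 Ω y z, alt_swap23 Ω y z p, alt_swap23 Ω y z q, a2]; ring
    have m1 : ∀ p q z, Ω ![R (-μ) p, R μ q, z] = 0 := fun p q z => by
      rw [alt_swap12, hpm, neg_zero]
    have m2 : Ω ![R μ x, R μ y, R (-μ) z] = 0 := by
      rw [alt_swap23, hpm, neg_zero]
    have m3 : Ω ![R (-μ) x, R (-μ) y, R μ z] = 0 := by
      rw [alt_swap23, m1, neg_zero]
    conv_lhs => rw [hsum x, hsum y, hsum z]
    simp only [a1, a2, a3, hpm, m1, m2, m3]
    ring
  have hne1 : Ω.compLinearMap (R μ) ![(f 0 : V), f 1, f 2] ≠ 0 := by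
    intro h0
    have h1 := hα0 h0
    rw [h1, zero_add] at hΩ
    have : (f 0 : V) = 0 := by
      refine h.nondeg hdim hε hμ (hfk 0) fun y z => ?_
      rw [hΩ]
      refine Ω.map_coord_zero (i := 0) ?_
      have := hsum (f 0)
      rw [hRid μ hμ _ (hfk 0)] at this
      simpa using this
    exact f.ne_zero 0 (Subtype.ext this)
  have hne2 : Ω.compLinearMap (R (-μ)) ![(g 0 : V), g 1, g 2] ≠ 0 := by
    intro h0
    have h1 := hβ0 h0
    rw [h1, add_zero] at hΩ
    have : (g 0 : V) = 0 := by
      refine h.nondeg hdim hε hν (hgk 0) fun y z => ?_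
      rw [hΩ]
      exact Ω.map_coord_zero (i := 0) (hgP 0)
    exact g.ne_zero 0 (Subtype.ext this)
  refine ⟨_, _, hα, hβ, fun hw => ?_, hΩ⟩
  have hs := wedge_split (Ω.compLinearMap (R μ)) (Ω.compLinearMap (R (-μ)))
    ![(f 0 : V), f 1, f 2, g 0, g 1, g 2] (by
      intro i hi y z
      refine Ω.map_coord_zero (i := 2) ?_
      fin_cases i
      · exact absurd hi (by decide)
      · exact absurd hi (by decide)
      · exact absurd hi (by decide)
      · exact hgP 0
      · exact hgP 1
      · exact hgP 2)
  rw [hw] at hs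
  exact mul_ne_zero hne1 hne2 hs.symm

end

/-- For `Ω ∈ Λ³V*` (V a 6-dimensional complex vector space),
`λ(Ω) ≠ 0` iff `Ω = α + β` with `α, β` decomposable and `α ∧ β ≠ 0`.
Here `K` is the endomorphism-valued map characterized by
`θ ∧ ι(v)Ω ∧ Ω = θ(K_Ω v) • ε` and `λ(Ω) = (1/6) tr(K_Ω²)`. -/
theorem stmt0 (V : Type*) [AddCommGroup V] [Module ℂ V] [FiniteDimensional ℂ V]
    (hdim : Module.finrank ℂ V = 6)
    (ε : AlternatingMap ℂ V ℂ (Fin 6)) (hε : ε ≠ 0)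
    (K : AlternatingMap ℂ V ℂ (Fin 3) → V →ₗ[ℂ] V)
    (hK : ∀ (Ω : AlternatingMap ℂ V ℂ (Fin 3)) (θ : V →ₗ[ℂ] ℂ) (v : V),
      wedge (oneForm θ) (wedge (Ω.curryLeft v) Ω) = θ (K Ω v) • ε)
    (Ω : AlternatingMap ℂ V ℂ (Fin 3)) :
    (6 : ℂ)⁻¹ * LinearMap.trace ℂ V (K Ω ∘ₗ K Ω) ≠ 0 ↔
      ∃ α β : AlternatingMap ℂ V ℂ (Fin 3),
        IsDecomposable α ∧ IsDecomposable β ∧ wedge α β ≠ 0 ∧ Ω = α + β := by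
  have h : IsK ε Ω (K Ω) := hK Ω
  constructor
  · intro ht
    exact decomp_of_trace_ne hdim hε h (right_ne_zero_of_mul ht)
  · rintro ⟨α, β, hα, hβ, hw, hΩ⟩
    exact mul_ne_zero (by norm_num) (trace_ne_of_decomp hdim hε h α β hα hβ hw hΩ)
end
end

section
/- For every Ω ∈ Λ³V*, let K_Ω*Ω denote the 3-form (K_Ω*Ω)(v₁,v₂,v₃) = Ω(K_Ω v₁, K_Ω v₂, K_Ω v₃). Then (i) K_Ω*Ω ∧ Ω = 2·λ(Ω)²·ε, and (ii) for every μ ∈ ℂ with μ² = λ(Ω), the 3-form μ³·Ω + K_Ω*Ω is decomposable. -/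
open scoped TensorProduct

noncomputable section

section WedgeCalc

variable {V : Type*} [AddCommGroup V] [Module ℂ V]

theorem wedge_eq_tmul {m n : ℕ}
    (α : AlternatingMap ℂ V ℂ (Fin m)) (β : AlternatingMap ℂ V ℂ (Fin n)) (v : Fin (m + n) → V) :
    wedge α β v = LinearMap.mul' ℂ ℂ
      ((AlternatingMap.domCoprod' (α ⊗ₜ[ℂ] β)) (fun i => v (finSumFinEquiv i))) := rfl

theorem wedge_add_left {m n : ℕ}
    (α α' : AlternatingMap ℂ V ℂ (Fin m)) (β : AlternatingMap ℂ V ℂ (Fin n)) :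
    wedge (α + α') β = wedge α β + wedge α' β := by
  ext v
  simp only [AlternatingMap.add_apply, wedge_eq_tmul, TensorProduct.add_tmul, map_add]

theorem wedge_add_right {m n : ℕ}
    (α : AlternatingMap ℂ V ℂ (Fin m)) (β β' : AlternatingMap ℂ V ℂ (Fin n)) :
    wedge α (β + β') = wedge α β + wedge α β' := by
  ext v
  simp only [AlternatingMap.add_apply, wedge_eq_tmul, TensorProduct.tmul_add, map_add]

theorem wedge_smul_left {m n : ℕ} (c : ℂ)
    (α : AlternatingMap ℂ V ℂ (Fin m)) (β : AlternatingMap ℂ V ℂ (Fin n)) :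
    wedge (c • α) β = c • wedge α β := by
  ext v
  simp only [AlternatingMap.smul_apply, wedge_eq_tmul, ← TensorProduct.smul_tmul', map_smul]

theorem wedge_smul_right {m n : ℕ} (c : ℂ)
    (α : AlternatingMap ℂ V ℂ (Fin m)) (β : AlternatingMap ℂ V ℂ (Fin n)) :
    wedge α (c • β) = c • wedge α β := by
  ext v
  simp only [AlternatingMap.smul_apply, wedge_eq_tmul, TensorProduct.tmul_smul, map_smul]

theorem wedge_perm_sum {m n k : ℕ} (h : m + n = k)
    (α : AlternatingMap ℂ V ℂ (Fin m)) (β : AlternatingMap ℂ V ℂ (Fin n)) (v : Fin k → V) :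
    ((m.factorial : ℂ) * n.factorial) * wedge α β (fun i => v (Fin.cast h i)) =
      ∑ σ : Equiv.Perm (Fin k), ((Equiv.Perm.sign σ : ℤ) : ℂ) *
        (α (fun i => v (σ (Fin.cast h (Fin.castAdd n i)))) *
          β (fun j => v (σ (Fin.cast h (Fin.natAdd m j))))) := by
  subst h
  have key := MultilinearMap.domCoprod_alternization_eq α β
  have key2 := congrArg (fun f => LinearMap.mul' ℂ ℂ (f (fun i => v (finSumFinEquiv i)))) key
  simp only [MultilinearMap.alternatization_apply, Fintype.card_fin, map_sum,
    AlternatingMap.smul_apply, map_nsmul] at key2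
  have e1 : LinearMap.mul' ℂ ℂ ((α.domCoprod β) (fun i => v (finSumFinEquiv i))) =
      wedge α β v := rfl
  rw [e1] at key2
  simp only [Fin.cast_eq_self]
  rw [nsmul_eq_mul] at key2
  push_cast at key2
  rw [← key2]
  refine Fintype.sum_equiv finSumFinEquiv.permCongr _ _ ?_
  intro σ
  simp only [Equiv.Perm.sign_permCongr]
  rw [Units.smul_def, map_zsmul, zsmul_eq_mul]
  congr 1
  simp [MultilinearMap.domDomCongr_apply, Equiv.permCongr_apply]

theorem perm_sum_succ {V : Type*} {k : ℕ} (G : (Fin (k + 1) → V) → ℂ) (v : Fin (k + 1) → V) :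
    ∑ σ : Equiv.Perm (Fin (k + 1)), ((Equiv.Perm.sign σ : ℤ) : ℂ) * G (fun i => v (σ i)) =
      ∑ p : Fin (k + 1), (-1 : ℂ) ^ (p : ℕ) * ∑ e : Equiv.Perm (Fin k),
        ((Equiv.Perm.sign e : ℤ) : ℂ) *
          G (Fin.cons (v p) (fun i => v (p.succAbove (e i)))) := by
  rw [← Equiv.sum_comp Equiv.Perm.decomposeFin.symm, Fintype.sum_prod_type]
  refine Finset.sum_congr rfl fun p _ => ?_
  induction p using Fin.cases with
  | zero =>
    simp only [Equiv.Perm.decomposeFin.symm_sign]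
    simp only [if_true, one_mul, Fin.val_zero, pow_zero]
    refine Finset.sum_congr rfl fun e _ => ?_
    congr 2
    funext i
    induction i using Fin.cases <;> simp
  | succ p =>
    obtain ⟨k', rfl⟩ : ∃ k', k = k' + 1 := ⟨k - 1, by have := p.2; omega⟩
    rw [Finset.mul_sum]
    conv_rhs => rw [← Equiv.sum_comp (Equiv.mulLeft p.cycleRange)]
    refine Finset.sum_congr rfl fun e _ => ?_
    have : (fun i => v (Equiv.Perm.decomposeFin.symm (p.succ, e) i)) =
        (Fin.cons (v p.succ)
          (fun i => v (p.succ.succAbove ((Equiv.mulLeft p.cycleRange e) i))) :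
            Fin (k' + 1 + 1) → V) := by
      funext i
      induction i using Fin.cases with
      | zero => simp
      | succ i => simp [Fin.succAbove_cycleRange]
    rw [this, ← mul_assoc, Equiv.Perm.decomposeFin.symm_sign]
    congr 1
    simp only [Fin.succ_ne_zero, if_false, Equiv.coe_mulLeft, Equiv.Perm.sign_mul,
      Fin.sign_cycleRange, Fin.val_succ]
    push_cast
    have hsq : ((-1 : ℂ) ^ (p : ℕ)) * (-1) ^ (p : ℕ) = 1 := by rw [← mul_pow]; simp
    linear_combination ((Equiv.Perm.sign e : ℤ) : ℂ) * hsq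

theorem wedge_rec {m n k : ℕ} (h : m + 1 + n = k + 1)
    (α : AlternatingMap ℂ V ℂ (Fin (m + 1))) (β : AlternatingMap ℂ V ℂ (Fin n))
    (v : Fin (k + 1) → V) :
    ((m : ℂ) + 1) * wedge α β (fun i => v (Fin.cast h i)) =
      ∑ p : Fin (k + 1), (-1 : ℂ) ^ (p : ℕ) *
        wedge (α.curryLeft (v p)) β
          (fun i => v (p.succAbove (Fin.cast (by omega : m + n = k) i))) := by
  have hf : ((m.factorial : ℂ) * n.factorial) ≠ 0 := by
    have := m.factorial_ne_zero
    have := n.factorial_ne_zero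
    simp_all
  apply mul_left_cancel₀ hf
  have h1 := wedge_perm_sum h α β v
  rw [Nat.factorial_succ] at h1
  push_cast at h1
  rw [show ((m.factorial : ℂ) * n.factorial) * (((m : ℂ) + 1) *
    wedge α β (fun i => v (Fin.cast h i))) = ((m : ℂ) + 1) * m.factorial * n.factorial *
    wedge α β (fun i => v (Fin.cast h i)) by ring, h1]
  rw [perm_sum_succ (fun u => α (fun i => u (Fin.cast h (Fin.castAdd n i))) *
          β (fun j => u (Fin.cast h (Fin.natAdd (m + 1) j))))]
  rw [Finset.mul_sum]
  refine Finset.sum_congr rfl fun p _ => ?_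
  have h2 := wedge_perm_sum (by omega : m + n = k) (α.curryLeft (v p)) β
    (fun i => v (p.succAbove i))
  rw [mul_left_comm, h2]
  congr 1
  refine Finset.sum_congr rfl fun e _ => ?_
  congr 2
  · rw [AlternatingMap.curryLeft_apply_apply]
    congr 1
    funext i
    induction i using Fin.cases with
    | zero => rfl
    | succ i =>
      have : Fin.cast h (Fin.castAdd n i.succ) =
        (Fin.cast (by omega : m + n = k) (Fin.castAdd n i)).succ := rfl
      rw [this]
      simp [Matrix.vecCons]
  · congr 1
    funext j
    have : Fin.cast h (Fin.natAdd (m + 1) j) =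
        (Fin.cast (by omega : m + n = k) (Fin.natAdd m j)).succ := by
      ext; simp; omega
    rw [this]
    simp

theorem wedge_zero_left {n k : ℕ} (h : 0 + n = k)
    (α : AlternatingMap ℂ V ℂ (Fin 0)) (β : AlternatingMap ℂ V ℂ (Fin n)) (v : Fin k → V) :
    wedge α β (fun i => v (Fin.cast h i)) =
      α ![] * β (fun i => v (Fin.cast (by omega) i)) := by
  obtain rfl : n = k := by omega
  have hf : (n.factorial : ℂ) ≠ 0 := by
    have := n.factorial_ne_zero
    simp_all
  apply mul_left_cancel₀ hf
  have h1 := wedge_perm_sum h α β v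
  simp only [Nat.factorial_zero, Nat.cast_one, one_mul] at h1
  rw [h1]
  have : ∀ σ : Equiv.Perm (Fin n), ((Equiv.Perm.sign σ : ℤ) : ℂ) *
        (α (fun i => v (σ (Fin.cast h (Fin.castAdd n i)))) *
          β (fun j => v (σ (Fin.cast h (Fin.natAdd 0 j))))) = α ![] * β v := by
    intro σ
    have e1 : (fun i => v (σ (Fin.cast h (Fin.castAdd n i)))) = ![] := Subsingleton.elim _ _
    have e2 : (fun j => v (σ (Fin.cast h (Fin.natAdd 0 j)))) = v ∘ σ := by
      funext j
      have : Fin.cast h (Fin.natAdd 0 j) = j := by ext; simp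
      rw [this]; rfl
    rw [e1, e2, β.map_perm, Units.smul_def, zsmul_eq_mul]
    rcases Int.units_eq_one_or (Equiv.Perm.sign σ) with hs | hs <;> simp [hs]
  rw [Finset.sum_congr rfl fun σ _ => this σ]
  simp [Fintype.card_perm]

theorem wedge_zero_right {n k : ℕ} (h : n + 0 = k)
    (α : AlternatingMap ℂ V ℂ (Fin n)) (β : AlternatingMap ℂ V ℂ (Fin 0)) (v : Fin k → V) :
    wedge α β (fun i => v (Fin.cast h i)) =
      α (fun i => v (Fin.cast (by omega) i)) * β ![] := by
  obtain rfl : n = k := by omega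
  have hf : (n.factorial : ℂ) ≠ 0 := by
    have := n.factorial_ne_zero
    simp_all
  apply mul_left_cancel₀ hf
  have h1 := wedge_perm_sum h α β v
  simp only [Nat.factorial_zero, Nat.cast_one, mul_one] at h1
  rw [h1]
  have : ∀ σ : Equiv.Perm (Fin n), ((Equiv.Perm.sign σ : ℤ) : ℂ) *
        (α (fun i => v (σ (Fin.cast h (Fin.castAdd 0 i)))) *
          β (fun j => v (σ (Fin.cast h (Fin.natAdd n j))))) = α v * β ![] := by
    intro σ
    have e1 : (fun i => v (σ (Fin.cast h (Fin.natAdd n i)))) = ![] := Subsingleton.elim _ _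
    have e2 : (fun j => v (σ (Fin.cast h (Fin.castAdd 0 j)))) = v ∘ σ := by
      funext j
      have : Fin.cast h (Fin.castAdd 0 j) = j := by ext; simp
      rw [this]; rfl
    rw [e1, e2, α.map_perm, Units.smul_def, zsmul_eq_mul]
    rcases Int.units_eq_one_or (Equiv.Perm.sign σ) with hs | hs <;> simp [hs]
  rw [Finset.sum_congr rfl fun σ _ => this σ]
  simp [Fintype.card_perm]

/-- Contraction of a wedge product (graded Leibniz rule). -/
theorem wedge_cons {m : ℕ} : ∀ {n k : ℕ} (h : m + 1 + (n + 1) = k + 2)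
    (α : AlternatingMap ℂ V ℂ (Fin (m + 1))) (β : AlternatingMap ℂ V ℂ (Fin (n + 1)))
    (w : V) (v : Fin (k + 1) → V),
    wedge α β (fun i => (Fin.cons w v : Fin (k + 2) → V) (Fin.cast h i)) =
      wedge (α.curryLeft w) β (fun i => v (Fin.cast (by omega) i)) +
      (-1) ^ (m + 1) * wedge α (β.curryLeft w) (fun i => v (Fin.cast (by omega) i)) := by
  induction m with
  | zero =>
    intro n k h α β w v
    have h1 := wedge_rec h α β (Fin.cons w v : Fin (k + 2) → V)
    have h2 := wedge_rec (by omega : 0 + 1 + n = k + 1) α (β.curryLeft w) v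
    simp only [Nat.cast_zero, zero_add, one_mul] at h1 h2
    rw [h1, h2, Fin.sum_univ_succ]
    simp only [Fin.val_zero, pow_zero, one_mul, Fin.cons_zero, Fin.succAbove_zero, Fin.cons_succ,
      zero_add, pow_one, neg_one_mul, Fin.val_succ]
    congr 1
    rw [← Finset.sum_neg_distrib]
    refine Finset.sum_congr rfl fun p _ => ?_
    have a1 := wedge_zero_left (by omega : 0 + (n + 1) = k + 1) (α.curryLeft (v p)) β
      (fun i => (Fin.cons w v : Fin (k + 2) → V) (p.succ.succAbove i))
    have a2 := wedge_zero_left (by omega : 0 + n = k) (α.curryLeft (v p)) (β.curryLeft w)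
      (fun i => v (p.succAbove i))
    rw [a1, a2, pow_succ, AlternatingMap.curryLeft_apply_apply β]
    have : (fun i => (Fin.cons w v : Fin (k + 2) → V) (p.succ.succAbove
        (Fin.cast (by omega : n + 1 = k + 1) i))) =
        Matrix.vecCons w (fun i => v (p.succAbove (Fin.cast (by omega) i))) := by
      funext i
      induction i using Fin.cases with
      | zero => simp
      | succ i => 
        have : Fin.cast (by omega : n + 1 = k + 1) i.succ =
          (Fin.cast (by omega : n = k) i).succ := rfl
        rw [this]
        simp
    rw [this]
    ring
  | succ m ih =>
    intro n k h α β w v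
    obtain ⟨k, rfl⟩ : ∃ k', k = k' + 1 := ⟨k - 1, by omega⟩
    have h1 := wedge_rec h α β (Fin.cons w v : Fin (k + 1 + 2) → V)
    have h2 := wedge_rec (by omega : m + 1 + 1 + n = k + 1 + 1) α (β.curryLeft w) v
    have h3 := wedge_rec (by omega : m + 1 + (n + 1) = k + 1 + 1) (α.curryLeft w) β v
    have hm : (((m + 1 : ℕ) : ℂ) + 1) ≠ 0 := by exact_mod_cast Nat.succ_ne_zero (m + 1)
    apply mul_left_cancel₀ hm
    rw [h1, mul_add, mul_left_comm, h2, Fin.sum_univ_succ]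
    push_cast
    rw [add_mul _ (1 : ℂ), h3]
    simp only [Fin.val_zero, pow_zero, one_mul, Fin.cons_zero, Fin.succAbove_zero, Fin.cons_succ,
      Fin.val_succ]
    rw [add_comm (Finset.sum _ _), add_assoc (G := ℂ)]
    congr 1
    rw [Finset.mul_sum, ← Finset.sum_add_distrib]
    refine Finset.sum_congr rfl fun p _ => ?_
    have a1 := ih (by omega : m + 1 + (n + 1) = k + 2) (α.curryLeft (v p)) β w
      (fun i => v (p.succAbove i))
    have : (fun i => (Fin.cons w v : Fin (k + 1 + 2) → V) (p.succ.succAbove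
        (Fin.cast (by omega : m + 1 + (n + 1) = k + 2) i))) =
        (fun i => (Fin.cons w (fun i => v (p.succAbove i)) : Fin (k + 2) → V)
        (Fin.cast (by omega : m + 1 + (n + 1) = k + 2) i)) := by
      funext i
      generalize Fin.cast _ i = j
      induction j using Fin.cases <;> simp
    rw [this, a1]
    have hs : (α.curryLeft (v p)).curryLeft w = - (α.curryLeft w).curryLeft (v p) := by
      ext u
      have := α.map_swap (Matrix.vecCons (v p) (Matrix.vecCons w u)) (i := 0) (j := 1) (by simp)
      simp only [AlternatingMap.curryLeft_apply_apply, AlternatingMap.neg_apply]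
      rw [eq_neg_iff_add_eq_zero, add_comm, ← eq_neg_iff_add_eq_zero, ← this]
      congr 1
      funext i
      refine Fin.cases ?_ (fun i => Fin.cases ?_ (fun i => ?_) i) i
      · simp
      · simp
      · rw [Function.comp, Equiv.swap_apply_of_ne_of_ne] <;> simp [Fin.ext_iff]
    have hneg : ∀ (γ : AlternatingMap ℂ V ℂ (Fin m)) u, wedge (-γ) β u = - wedge γ β u := by
      intro γ u
      rw [← neg_one_smul ℂ γ, wedge_smul_left]
      simp
    rw [hs, hneg]
    ring
set_option maxRecDepth 10000

theorem wedge_0_1 (α : AlternatingMap ℂ V ℂ (Fin 0)) (β : AlternatingMap ℂ V ℂ (Fin 1))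
    (a : V) : wedge α β ![a] =
      α ![] * β ![a] := by
  refine (wedge_zero_left (n := 1) (k := 1) rfl α β ![a]).trans ?_
  rfl

theorem wedge_0_2 (α : AlternatingMap ℂ V ℂ (Fin 0)) (β : AlternatingMap ℂ V ℂ (Fin 2))
    (a b : V) : wedge α β ![a, b] =
      α ![] * β ![a, b] := by
  refine (wedge_zero_left (n := 2) (k := 2) rfl α β ![a, b]).trans ?_
  rfl

theorem wedge_0_3 (α : AlternatingMap ℂ V ℂ (Fin 0)) (β : AlternatingMap ℂ V ℂ (Fin 3))
    (a b c : V) : wedge α β ![a, b, c] =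
      α ![] * β ![a, b, c] := by
  refine (wedge_zero_left (n := 3) (k := 3) rfl α β ![a, b, c]).trans ?_
  rfl

theorem wedge_0_4 (α : AlternatingMap ℂ V ℂ (Fin 0)) (β : AlternatingMap ℂ V ℂ (Fin 4))
    (a b c d : V) : wedge α β ![a, b, c, d] =
      α ![] * β ![a, b, c, d] := by
  refine (wedge_zero_left (n := 4) (k := 4) rfl α β ![a, b, c, d]).trans ?_
  rfl

theorem wedge_0_5 (α : AlternatingMap ℂ V ℂ (Fin 0)) (β : AlternatingMap ℂ V ℂ (Fin 5))
    (a b c d e : V) : wedge α β ![a, b, c, d, e] =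
      α ![] * β ![a, b, c, d, e] := by
  refine (wedge_zero_left (n := 5) (k := 5) rfl α β ![a, b, c, d, e]).trans ?_
  rfl

theorem wedge_1_0 (α : AlternatingMap ℂ V ℂ (Fin 1)) (β : AlternatingMap ℂ V ℂ (Fin 0))
    (a : V) : wedge α β ![a] =
      α ![a] * β ![] := by
  refine (wedge_zero_right (n := 1) (k := 1) rfl α β ![a]).trans ?_
  rfl

theorem wedge_1_1 (α : AlternatingMap ℂ V ℂ (Fin 1)) (β : AlternatingMap ℂ V ℂ (Fin 1))
    (a b : V) : wedge α β ![a, b] =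
      α ![a] * β ![b] - α ![b] * β ![a] := by
  refine (wedge_cons (m := 0) (n := 0) (k := 0) rfl α β a ![b]).trans ?_
  have h1 := wedge_0_1 (α.curryLeft a) β b
  have h2 := wedge_1_0 α (β.curryLeft a) b
  refine (congrArg₂ (fun s t => s + (-1) ^ 1 * t) h1 h2).trans ?_
  simp only [AlternatingMap.curryLeft_apply_apply]
  ring

theorem wedge_1_2 (α : AlternatingMap ℂ V ℂ (Fin 1)) (β : AlternatingMap ℂ V ℂ (Fin 2))
    (a b c : V) : wedge α β ![a, b, c] =
      α ![a] * β ![b, c] - α ![b] * β ![a, c]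
      + α ![c] * β ![a, b] := by
  refine (wedge_cons (m := 0) (n := 1) (k := 1) rfl α β a ![b, c]).trans ?_
  have h1 := wedge_0_2 (α.curryLeft a) β b c
  have h2 := wedge_1_1 α (β.curryLeft a) b c
  refine (congrArg₂ (fun s t => s + (-1) ^ 1 * t) h1 h2).trans ?_
  simp only [AlternatingMap.curryLeft_apply_apply]
  ring

theorem wedge_1_3 (α : AlternatingMap ℂ V ℂ (Fin 1)) (β : AlternatingMap ℂ V ℂ (Fin 3))
    (a b c d : V) : wedge α β ![a, b, c, d] =
      α ![a] * β ![b, c, d] - α ![b] * β ![a, c, d]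
      + α ![c] * β ![a, b, d] - α ![d] * β ![a, b, c] := by
  refine (wedge_cons (m := 0) (n := 2) (k := 2) rfl α β a ![b, c, d]).trans ?_
  have h1 := wedge_0_3 (α.curryLeft a) β b c d
  have h2 := wedge_1_2 α (β.curryLeft a) b c d
  refine (congrArg₂ (fun s t => s + (-1) ^ 1 * t) h1 h2).trans ?_
  simp only [AlternatingMap.curryLeft_apply_apply]
  ring

theorem wedge_1_4 (α : AlternatingMap ℂ V ℂ (Fin 1)) (β : AlternatingMap ℂ V ℂ (Fin 4))
    (a b c d e : V) : wedge α β ![a, b, c, d, e] =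
      α ![a] * β ![b, c, d, e] - α ![b] * β ![a, c, d, e]
      + α ![c] * β ![a, b, d, e] - α ![d] * β ![a, b, c, e]
      + α ![e] * β ![a, b, c, d] := by
  refine (wedge_cons (m := 0) (n := 3) (k := 3) rfl α β a ![b, c, d, e]).trans ?_
  have h1 := wedge_0_4 (α.curryLeft a) β b c d e
  have h2 := wedge_1_3 α (β.curryLeft a) b c d e
  refine (congrArg₂ (fun s t => s + (-1) ^ 1 * t) h1 h2).trans ?_
  simp only [AlternatingMap.curryLeft_apply_apply]
  ring

theorem wedge_1_5 (α : AlternatingMap ℂ V ℂ (Fin 1)) (β : AlternatingMap ℂ V ℂ (Fin 5))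
    (a b c d e f : V) : wedge α β ![a, b, c, d, e, f] =
      α ![a] * β ![b, c, d, e, f] - α ![b] * β ![a, c, d, e, f]
      + α ![c] * β ![a, b, d, e, f] - α ![d] * β ![a, b, c, e, f]
      + α ![e] * β ![a, b, c, d, f] - α ![f] * β ![a, b, c, d, e] := by
  refine (wedge_cons (m := 0) (n := 4) (k := 4) rfl α β a ![b, c, d, e, f]).trans ?_
  have h1 := wedge_0_5 (α.curryLeft a) β b c d e f
  have h2 := wedge_1_4 α (β.curryLeft a) b c d e f
  refine (congrArg₂ (fun s t => s + (-1) ^ 1 * t) h1 h2).trans ?_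
  simp only [AlternatingMap.curryLeft_apply_apply]
  ring

theorem wedge_2_0 (α : AlternatingMap ℂ V ℂ (Fin 2)) (β : AlternatingMap ℂ V ℂ (Fin 0))
    (a b : V) : wedge α β ![a, b] =
      α ![a, b] * β ![] := by
  refine (wedge_zero_right (n := 2) (k := 2) rfl α β ![a, b]).trans ?_
  rfl

theorem wedge_2_1 (α : AlternatingMap ℂ V ℂ (Fin 2)) (β : AlternatingMap ℂ V ℂ (Fin 1))
    (a b c : V) : wedge α β ![a, b, c] =
      α ![a, b] * β ![c] - α ![a, c] * β ![b]
      + α ![b, c] * β ![a] := by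
  refine (wedge_cons (m := 1) (n := 0) (k := 1) rfl α β a ![b, c]).trans ?_
  have h1 := wedge_1_1 (α.curryLeft a) β b c
  have h2 := wedge_2_0 α (β.curryLeft a) b c
  refine (congrArg₂ (fun s t => s + (-1) ^ 2 * t) h1 h2).trans ?_
  simp only [AlternatingMap.curryLeft_apply_apply]
  ring

theorem wedge_2_2 (α : AlternatingMap ℂ V ℂ (Fin 2)) (β : AlternatingMap ℂ V ℂ (Fin 2))
    (a b c d : V) : wedge α β ![a, b, c, d] =
      α ![a, b] * β ![c, d] - α ![a, c] * β ![b, d]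
      + α ![a, d] * β ![b, c] + α ![b, c] * β ![a, d]
      - α ![b, d] * β ![a, c] + α ![c, d] * β ![a, b] := by
  refine (wedge_cons (m := 1) (n := 1) (k := 2) rfl α β a ![b, c, d]).trans ?_
  have h1 := wedge_1_2 (α.curryLeft a) β b c d
  have h2 := wedge_2_1 α (β.curryLeft a) b c d
  refine (congrArg₂ (fun s t => s + (-1) ^ 2 * t) h1 h2).trans ?_
  simp only [AlternatingMap.curryLeft_apply_apply]
  ring

theorem wedge_2_3 (α : AlternatingMap ℂ V ℂ (Fin 2)) (β : AlternatingMap ℂ V ℂ (Fin 3))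
    (a b c d e : V) : wedge α β ![a, b, c, d, e] =
      α ![a, b] * β ![c, d, e] - α ![a, c] * β ![b, d, e]
      + α ![a, d] * β ![b, c, e] - α ![a, e] * β ![b, c, d]
      + α ![b, c] * β ![a, d, e] - α ![b, d] * β ![a, c, e]
      + α ![b, e] * β ![a, c, d] + α ![c, d] * β ![a, b, e]
      - α ![c, e] * β ![a, b, d] + α ![d, e] * β ![a, b, c] := by
  refine (wedge_cons (m := 1) (n := 2) (k := 3) rfl α β a ![b, c, d, e]).trans ?_
  have h1 := wedge_1_3 (α.curryLeft a) β b c d e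
  have h2 := wedge_2_2 α (β.curryLeft a) b c d e
  refine (congrArg₂ (fun s t => s + (-1) ^ 2 * t) h1 h2).trans ?_
  simp only [AlternatingMap.curryLeft_apply_apply]
  ring

theorem wedge_2_4 (α : AlternatingMap ℂ V ℂ (Fin 2)) (β : AlternatingMap ℂ V ℂ (Fin 4))
    (a b c d e f : V) : wedge α β ![a, b, c, d, e, f] =
      α ![a, b] * β ![c, d, e, f] - α ![a, c] * β ![b, d, e, f]
      + α ![a, d] * β ![b, c, e, f] - α ![a, e] * β ![b, c, d, f]
      + α ![a, f] * β ![b, c, d, e] + α ![b, c] * β ![a, d, e, f]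
      - α ![b, d] * β ![a, c, e, f] + α ![b, e] * β ![a, c, d, f]
      - α ![b, f] * β ![a, c, d, e] + α ![c, d] * β ![a, b, e, f]
      - α ![c, e] * β ![a, b, d, f] + α ![c, f] * β ![a, b, d, e]
      + α ![d, e] * β ![a, b, c, f] - α ![d, f] * β ![a, b, c, e]
      + α ![e, f] * β ![a, b, c, d] := by
  refine (wedge_cons (m := 1) (n := 3) (k := 4) rfl α β a ![b, c, d, e, f]).trans ?_
  have h1 := wedge_1_4 (α.curryLeft a) β b c d e f
  have h2 := wedge_2_3 α (β.curryLeft a) b c d e f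
  refine (congrArg₂ (fun s t => s + (-1) ^ 2 * t) h1 h2).trans ?_
  simp only [AlternatingMap.curryLeft_apply_apply]
  ring

theorem wedge_3_0 (α : AlternatingMap ℂ V ℂ (Fin 3)) (β : AlternatingMap ℂ V ℂ (Fin 0))
    (a b c : V) : wedge α β ![a, b, c] =
      α ![a, b, c] * β ![] := by
  refine (wedge_zero_right (n := 3) (k := 3) rfl α β ![a, b, c]).trans ?_
  rfl

theorem wedge_3_1 (α : AlternatingMap ℂ V ℂ (Fin 3)) (β : AlternatingMap ℂ V ℂ (Fin 1))
    (a b c d : V) : wedge α β ![a, b, c, d] =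
      α ![a, b, c] * β ![d] - α ![a, b, d] * β ![c]
      + α ![a, c, d] * β ![b] - α ![b, c, d] * β ![a] := by
  refine (wedge_cons (m := 2) (n := 0) (k := 2) rfl α β a ![b, c, d]).trans ?_
  have h1 := wedge_2_1 (α.curryLeft a) β b c d
  have h2 := wedge_3_0 α (β.curryLeft a) b c d
  refine (congrArg₂ (fun s t => s + (-1) ^ 3 * t) h1 h2).trans ?_
  simp only [AlternatingMap.curryLeft_apply_apply]
  ring

theorem wedge_3_2 (α : AlternatingMap ℂ V ℂ (Fin 3)) (β : AlternatingMap ℂ V ℂ (Fin 2))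
    (a b c d e : V) : wedge α β ![a, b, c, d, e] =
      α ![a, b, c] * β ![d, e] - α ![a, b, d] * β ![c, e]
      + α ![a, b, e] * β ![c, d] + α ![a, c, d] * β ![b, e]
      - α ![a, c, e] * β ![b, d] + α ![a, d, e] * β ![b, c]
      - α ![b, c, d] * β ![a, e] + α ![b, c, e] * β ![a, d]
      - α ![b, d, e] * β ![a, c] + α ![c, d, e] * β ![a, b] := by
  refine (wedge_cons (m := 2) (n := 1) (k := 3) rfl α β a ![b, c, d, e]).trans ?_
  have h1 := wedge_2_2 (α.curryLeft a) β b c d e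
  have h2 := wedge_3_1 α (β.curryLeft a) b c d e
  refine (congrArg₂ (fun s t => s + (-1) ^ 3 * t) h1 h2).trans ?_
  simp only [AlternatingMap.curryLeft_apply_apply]
  ring

theorem wedge_3_3 (α : AlternatingMap ℂ V ℂ (Fin 3)) (β : AlternatingMap ℂ V ℂ (Fin 3))
    (a b c d e f : V) : wedge α β ![a, b, c, d, e, f] =
      α ![a, b, c] * β ![d, e, f] - α ![a, b, d] * β ![c, e, f]
      + α ![a, b, e] * β ![c, d, f] - α ![a, b, f] * β ![c, d, e]
      + α ![a, c, d] * β ![b, e, f] - α ![a, c, e] * β ![b, d, f]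
      + α ![a, c, f] * β ![b, d, e] + α ![a, d, e] * β ![b, c, f]
      - α ![a, d, f] * β ![b, c, e] + α ![a, e, f] * β ![b, c, d]
      - α ![b, c, d] * β ![a, e, f] + α ![b, c, e] * β ![a, d, f]
      - α ![b, c, f] * β ![a, d, e] - α ![b, d, e] * β ![a, c, f]
      + α ![b, d, f] * β ![a, c, e] - α ![b, e, f] * β ![a, c, d]
      + α ![c, d, e] * β ![a, b, f] - α ![c, d, f] * β ![a, b, e]
      + α ![c, e, f] * β ![a, b, d] - α ![d, e, f] * β ![a, b, c] := by
  refine (wedge_cons (m := 2) (n := 2) (k := 4) rfl α β a ![b, c, d, e, f]).trans ?_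
  have h1 := wedge_2_3 (α.curryLeft a) β b c d e f
  have h2 := wedge_3_2 α (β.curryLeft a) b c d e f
  refine (congrArg₂ (fun s t => s + (-1) ^ 3 * t) h1 h2).trans ?_
  simp only [AlternatingMap.curryLeft_apply_apply]
  ring

theorem oneForm_vec (θ : V →ₗ[ℂ] ℂ) (a : V) : oneForm θ ![a] = θ a := rfl

theorem wedge_left_comm (θ : AlternatingMap ℂ V ℂ (Fin 1)) (α : AlternatingMap ℂ V ℂ (Fin 2))
    (β : AlternatingMap ℂ V ℂ (Fin 3)) (a b c d e f : V) :
    wedge α (wedge θ β) ![a, b, c, d, e, f] = wedge θ (wedge α β) ![a, b, c, d, e, f] := by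
  have h1 := wedge_2_4 α (wedge θ β) a b c d e f
  have h2 := wedge_1_5 θ (wedge α β) a b c d e f
  have h3 := wedge_1_3 θ β
  have h4 := wedge_2_3 α β
  refine h1.trans (Eq.trans ?_ h2.symm)
  simp only [h3, h4]
  ring

theorem wedge_assoc_123 (θ : AlternatingMap ℂ V ℂ (Fin 1)) (α : AlternatingMap ℂ V ℂ (Fin 2))
    (β : AlternatingMap ℂ V ℂ (Fin 3)) (a b c d e f : V) :
    wedge (wedge θ α) β ![a, b, c, d, e, f] = wedge θ (wedge α β) ![a, b, c, d, e, f] := by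
  have h1 := wedge_3_3 (wedge θ α) β a b c d e f
  have h2 := wedge_1_5 θ (wedge α β) a b c d e f
  have h3 := wedge_1_2 θ α
  have h4 := wedge_2_3 α β
  refine h1.trans (Eq.trans ?_ h2.symm)
  simp only [h3, h4]
  ring

theorem vec_eta_4 {V : Type*} (x : Fin 4 → V) : x = ![x 0, x 1, x 2, x 3] := by
  funext i; fin_cases i <;> rfl

theorem vec_eta_5 {V : Type*} (x : Fin 5 → V) : x = ![x 0, x 1, x 2, x 3, x 4] := by
  funext i; fin_cases i <;> rfl

theorem vec_eta_6 {V : Type*} (x : Fin 6 → V) : x = ![x 0, x 1, x 2, x 3, x 4, x 5] := by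
  funext i; fin_cases i <;> rfl

theorem wedge_comm_22 (α β : AlternatingMap ℂ V ℂ (Fin 2)) : wedge α β = wedge β α := by
  ext x
  rw [vec_eta_4 x]
  refine (wedge_2_2 α β _ _ _ _).trans (Eq.trans ?_ (wedge_2_2 β α _ _ _ _).symm)
  ring

theorem wedge_comm_32 (α : AlternatingMap ℂ V ℂ (Fin 3)) (β : AlternatingMap ℂ V ℂ (Fin 2)) :
    wedge α β = wedge β α := by
  ext x
  rw [vec_eta_5 x]
  refine (wedge_3_2 α β _ _ _ _ _).trans (Eq.trans ?_ (wedge_2_3 β α _ _ _ _ _).symm)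
  ring

theorem wedge_self_3 (α : AlternatingMap ℂ V ℂ (Fin 3)) : wedge α α = 0 := by
  ext x
  rw [vec_eta_6 x]
  refine (wedge_3_3 α α _ _ _ _ _ _).trans ?_
  rw [AlternatingMap.zero_apply]
  ring

theorem curryLeft_wedge_23 (α : AlternatingMap ℂ V ℂ (Fin 2)) (β : AlternatingMap ℂ V ℂ (Fin 3))
    (w : V) : AlternatingMap.curryLeft (n := 4) (wedge α β) w =
      wedge (α.curryLeft w) β + wedge α (β.curryLeft w) := by
  ext x
  refine (wedge_cons (m := 1) (n := 2) (k := 3) rfl α β w x).trans ?_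
  norm_num

theorem curryLeft_wedge_33 (α : AlternatingMap ℂ V ℂ (Fin 3)) (β : AlternatingMap ℂ V ℂ (Fin 3))
    (w : V) : AlternatingMap.curryLeft (n := 5) (wedge α β) w =
      wedge (α.curryLeft w) β + (-1 : ℂ) • wedge α (β.curryLeft w) := by
  ext x
  refine (wedge_cons (m := 2) (n := 2) (k := 4) rfl α β w x).trans ?_
  norm_num

theorem seven_zero [FiniteDimensional ℂ V] (hdim : Module.finrank ℂ V = 6)
    (η : AlternatingMap ℂ V ℂ (Fin 7)) (x : Fin 7 → V) : η x = 0 := by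
  apply η.map_linearDependent
  intro h
  have := h.fintype_card_le_finrank
  rw [hdim] at this
  simp at this

theorem wedge_cons_25 (α : AlternatingMap ℂ V ℂ (Fin 2)) (δ : AlternatingMap ℂ V ℂ (Fin 5))
    (w : V) (x : Fin 6 → V) : wedge α δ (Matrix.vecCons w x) =
      wedge (α.curryLeft w) δ x + wedge α (δ.curryLeft w) x := by
  have h := (wedge_cons (m := 1) (n := 4) (k := 5) rfl α δ w x)
  simp only [Fin.cast_eq_self, ← Matrix.vecCons.eq_1] at h
  with_reducible refine h.trans ?_
  norm_num

theorem wedge_cons_16 (θ : V →ₗ[ℂ] ℂ) (δ : AlternatingMap ℂ V ℂ (Fin 6))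
    (w : V) (x : Fin 6 → V) : wedge (oneForm θ) δ (Matrix.vecCons w x) =
      θ w * δ x - wedge (oneForm θ) (δ.curryLeft w) x := by
  have h := (wedge_cons (m := 0) (n := 5) (k := 5) rfl (oneForm θ) δ w x)
  simp only [Fin.cast_eq_self, ← Matrix.vecCons.eq_1] at h
  with_reducible refine h.trans ?_
  have h5 := wedge_zero_left (n := 6) (k := 6) rfl ((oneForm θ).curryLeft w) δ x
  simp only [Fin.cast_eq_self] at h5
  with_reducible refine (congrArg (fun t => t + (-1) ^ (0 + 1) *
    wedge (oneForm θ) (δ.curryLeft w) x) h5).trans ?_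
  simp [sub_eq_add_neg]
  left
  rfl

theorem contract_27 [FiniteDimensional ℂ V] (hdim : Module.finrank ℂ V = 6)
    (α β : AlternatingMap ℂ V ℂ (Fin 2)) (γ : AlternatingMap ℂ V ℂ (Fin 3)) (w : V)
    (x : Fin 6 → V) :
    wedge (α.curryLeft w) (wedge β γ) x + wedge α (wedge (β.curryLeft w) γ) x
      + wedge α (wedge β (γ.curryLeft w)) x = 0 := by
  have h1 := wedge_cons_25 α (wedge β γ) w x
  have h0 := seven_zero hdim (wedge α (wedge β γ)) (Matrix.vecCons w x)
  have h4 : wedge α (wedge (β.curryLeft w) γ + wedge β (γ.curryLeft w)) x = 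
      wedge α (wedge (β.curryLeft w) γ) x + wedge α (wedge β (γ.curryLeft w)) x := by
    rw [wedge_add_right]; rfl
  rw [← curryLeft_wedge_23] at h4
  have h2 := h1.symm
  with_reducible replace h2 := h2.trans h0
  linear_combination h2 - h4

theorem contract_17 [FiniteDimensional ℂ V] (hdim : Module.finrank ℂ V = 6)
    (θ : V →ₗ[ℂ] ℂ) (β γ : AlternatingMap ℂ V ℂ (Fin 3)) (w : V)
    (x : Fin 6 → V) :
    θ w * wedge β γ x - wedge (oneForm θ) (wedge (β.curryLeft w) γ) x
      + wedge (oneForm θ) (wedge β (γ.curryLeft w)) x = 0 := by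
  have h1 := wedge_cons_16 θ (wedge β γ) w x
  have h0 := seven_zero hdim (wedge (oneForm θ) (wedge β γ)) (Matrix.vecCons w x)
  have h4 : wedge (oneForm θ) (wedge (β.curryLeft w) γ + (-1 : ℂ) • wedge β (γ.curryLeft w)) x = 
      wedge (oneForm θ) (wedge (β.curryLeft w) γ) x
        + (-1 : ℂ) * wedge (oneForm θ) (wedge β (γ.curryLeft w)) x := by
    rw [wedge_add_right, wedge_smul_right]; rfl
  rw [← curryLeft_wedge_33] at h4
  have h2 := h1.symm
  with_reducible replace h2 := h2.trans h0
  linear_combination h2 + h4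

/-- Symmetry of `K` with respect to `Ω`. -/
theorem K_symm [FiniteDimensional ℂ V] (hdim : Module.finrank ℂ V = 6)
    (ε : AlternatingMap ℂ V ℂ (Fin 6)) (hε : ε ≠ 0) (Ω : AlternatingMap ℂ V ℂ (Fin 3))
    (K : V →ₗ[ℂ] V)
    (hK : ∀ (θ : V →ₗ[ℂ] ℂ) (v : V),
      wedge (oneForm θ) (wedge (Ω.curryLeft v) Ω) = θ (K v) • ε) (u v w : V) :
    Ω ![v, w, K u] = Ω ![u, v, K w] := by
  obtain ⟨x, hx⟩ : ∃ x, ε x ≠ 0 := by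
    by_contra! h
    exact hε (AlternatingMap.ext h)
  have hF : ∀ u w v : V, wedge ((Ω.curryLeft u).curryLeft w) (wedge (Ω.curryLeft v) Ω) x =
      Ω ![u, w, K v] * ε x := by
    intro u w v
    have := hK ((AlternatingMap.ofSubsingleton ℂ V ℂ (0 : Fin 1)).symm
      ((Ω.curryLeft u).curryLeft w)) v
    rw [oneForm, Equiv.apply_symm_apply] at this
    refine (congrArg (fun f : AlternatingMap ℂ V ℂ (Fin 6) => f x) this).trans ?_
    refine congrArg (fun t => t * ε x) ?_
    change Ω (Matrix.vecCons u (Matrix.vecCons w fun _ => K v)) = _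
    congr 1
    funext i
    fin_cases i <;> rfl
  have hS : ∀ u v w : V, Ω ![u, w, K v] * ε x + Ω ![v, w, K u] * ε x
      + wedge (Ω.curryLeft u) (wedge (Ω.curryLeft v) (Ω.curryLeft w)) x = 0 := by
    intro u v w
    have h1 := contract_27 hdim (Ω.curryLeft u) (Ω.curryLeft v) Ω w x
    have h2 := wedge_left_comm ((Ω.curryLeft v).curryLeft w) (Ω.curryLeft u) Ω
      (x 0) (x 1) (x 2) (x 3) (x 4) (x 5)
    rw [← vec_eta_6 x] at h2
    have h3 := hF u w v
    have h4 := hF v w u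
    linear_combination h1 - h2 - h3 - h4
  have hE : ∀ u v w : V, Ω ![u, w, K v] + Ω ![v, w, K u] =
      Ω ![u, v, K w] + Ω ![w, v, K u] := by
    intro u v w
    have h1 := hS u v w
    have h2 := hS u w v
    rw [wedge_comm_22 (Ω.curryLeft w)] at h2
    apply mul_right_cancel₀ hx
    linear_combination h1 - h2
  have hA : ∀ a b c : V, Ω ![a, b, c] = - Ω ![b, a, c] := by
    intro a b c
    have := Ω.map_swap ![b, a, c] (i := 0) (j := 1) (by simp)
    rw [← this]
    congr 1
    funext i
    fin_cases i <;> rfl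
  have e1 := hE u v w
  have e2 := hE v w u
  have e3 := hE w u v
  have a1 := hA u w (K v)
  have a2 := hA v u (K w)
  have a3 := hA w v (K u)
  linear_combination (1/3 : ℂ) * (e1 - a1 + a3) - (1/3 : ℂ) * (e3 - a3 + a2)


/-- The derivation action of `L` on `Ω`, written through a basis. -/
def derivForm (b : Module.Basis (Fin 6) ℂ V) (L : V →ₗ[ℂ] V) (Ω : AlternatingMap ℂ V ℂ (Fin 3)) :
    AlternatingMap ℂ V ℂ (Fin 3) :=
  ∑ i, wedge (oneForm (b.coord i ∘ₗ L)) (Ω.curryLeft (b i))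

theorem alt_sum_apply {n : ℕ} (g : Fin 6 → AlternatingMap ℂ V ℂ (Fin n)) (v : Fin n → V) :
    (∑ i, g i) v = ∑ i, g i v := by
  let E : AlternatingMap ℂ V ℂ (Fin n) →ₗ[ℂ] ℂ :=
    { toFun := fun α => α v
      map_add' := fun _ _ => rfl
      map_smul' := fun _ _ => rfl }
  exact map_sum E g Finset.univ

theorem derivForm_apply (b : Module.Basis (Fin 6) ℂ V) (L : V →ₗ[ℂ] V)
    (Ω : AlternatingMap ℂ V ℂ (Fin 3)) (x y z : V) :
    derivForm b L Ω ![x, y, z] =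
      Ω ![L x, y, z] - Ω ![L y, x, z] + Ω ![L z, x, y] := by
  have hs : ∀ u y z : V, Ω ![u, y, z] = ∑ i, b.coord i u * Ω ![b i, y, z] := by
    intro u y z
    have h1 : Ω.curryLeft u = ∑ i, b.coord i u • Ω.curryLeft (b i) := by
      conv_lhs => rw [← b.sum_repr u, map_sum]
      simp
    have h2 := congrArg (fun f => f ![y, z]) h1
    simpa [alt_sum_apply] using h2
  rw [hs (L x), hs (L y), hs (L z), ← Finset.sum_sub_distrib, ← Finset.sum_add_distrib]
  rw [derivForm, alt_sum_apply]
  refine Finset.sum_congr rfl fun i _ => ?_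
  exact wedge_1_2 (oneForm (b.coord i ∘ₗ L)) (Ω.curryLeft (b i)) x y z

theorem wedge_derivForm (b : Module.Basis (Fin 6) ℂ V) (ε : AlternatingMap ℂ V ℂ (Fin 6))
    (Ω : AlternatingMap ℂ V ℂ (Fin 3)) (K : V →ₗ[ℂ] V)
    (hK : ∀ (θ : V →ₗ[ℂ] ℂ) (v : V),
      wedge (oneForm θ) (wedge (Ω.curryLeft v) Ω) = θ (K v) • ε) (L : V →ₗ[ℂ] V) :
    wedge (derivForm b L Ω) Ω = LinearMap.trace ℂ V (L ∘ₗ K) • ε := by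
  have hsum : ∀ s : Finset (Fin 6), ∀ g : Fin 6 → AlternatingMap ℂ V ℂ (Fin 3),
      wedge (∑ i ∈ s, g i) Ω = ∑ i ∈ s, wedge (g i) Ω := by
    intro s g
    let W : AlternatingMap ℂ V ℂ (Fin 3) →ₗ[ℂ] AlternatingMap ℂ V ℂ (Fin (3 + 3)) :=
      { toFun := fun α => wedge α Ω
        map_add' := fun α α' => wedge_add_left α α' Ω
        map_smul' := fun c α => wedge_smul_left c α Ω }
    exact map_sum W g s
  have htr : LinearMap.trace ℂ V (L ∘ₗ K) = ∑ i, b.coord i (L (K (b i))) := by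
    rw [LinearMap.trace_eq_matrix_trace ℂ b, Matrix.trace]
    simp [LinearMap.toMatrix_apply]
  rw [derivForm]
  refine (hsum _ _).trans ?_
  rw [htr, Finset.sum_smul]
  refine Finset.sum_congr rfl fun i _ => ?_
  rw [← LinearMap.comp_apply (b.coord i) L]
  refine Eq.trans ?_ (hK (b.coord i ∘ₗ L) (b i))
  ext x
  rw [vec_eta_6 x]
  exact wedge_assoc_123 _ _ _ _ _ _ _ _ _

theorem sum_update_trace (b : Module.Basis (Fin 6) ℂ V) (η : AlternatingMap ℂ V ℂ (Fin 6))
    (K : V →ₗ[ℂ] V) :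
    ∑ i, η (Function.update b i (K (b i))) = LinearMap.trace ℂ V K * η b := by
  have htr : LinearMap.trace ℂ V K = ∑ i, b.coord i (K (b i)) := by
    rw [LinearMap.trace_eq_matrix_trace ℂ b, Matrix.trace]
    simp [LinearMap.toMatrix_apply]
  rw [htr, Finset.sum_mul]
  refine Finset.sum_congr rfl fun i _ => ?_
  conv_lhs => rw [← b.sum_repr (K (b i))]
  rw [η.map_update_sum, Finset.sum_eq_single i]
  · rw [η.map_update_smul, Function.update_eq_self]
    simp
  · intro j _ hj
    rw [η.map_update_smul, η.map_update_self _ hj.symm, smul_zero]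
  · simp

theorem deriv_expand (Ω Ωh : AlternatingMap ℂ V ℂ (Fin 3)) (K : V →ₗ[ℂ] V)
    (h1 : ∀ x y z, Ω ![K x, y, z] = Ωh ![x, y, z])
    (h2 : ∀ x y z, Ω ![x, K y, z] = Ωh ![x, y, z])
    (h3 : ∀ x y z, Ω ![x, y, K z] = Ωh ![x, y, z])
    (θ : V →ₗ[ℂ] ℂ) (v a b c d e f : V) :
    wedge (oneForm θ) (wedge (Ω.curryLeft v) Ω) ![K a, b, c, d, e, f] +
    wedge (oneForm θ) (wedge (Ω.curryLeft v) Ω) ![a, K b, c, d, e, f] +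
    wedge (oneForm θ) (wedge (Ω.curryLeft v) Ω) ![a, b, K c, d, e, f] +
    wedge (oneForm θ) (wedge (Ω.curryLeft v) Ω) ![a, b, c, K d, e, f] +
    wedge (oneForm θ) (wedge (Ω.curryLeft v) Ω) ![a, b, c, d, K e, f] +
    wedge (oneForm θ) (wedge (Ω.curryLeft v) Ω) ![a, b, c, d, e, K f] =
    wedge (oneForm (θ ∘ₗ K)) (wedge (Ω.curryLeft v) Ω) ![a, b, c, d, e, f] +
    2 * wedge (oneForm θ) (wedge (Ωh.curryLeft v) Ω) ![a, b, c, d, e, f] +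
    3 * wedge (oneForm θ) (wedge (Ω.curryLeft v) Ωh) ![a, b, c, d, e, f] := by
  have g : ∀ (θ : V →ₗ[ℂ] ℂ) (δ : AlternatingMap ℂ V ℂ (Fin 5)), _ :=
    fun θ δ => wedge_1_5 (oneForm θ) δ
  have g1 := fun θ => g θ (wedge (Ω.curryLeft v) Ω)
  have g2 := fun θ => g θ (wedge (Ωh.curryLeft v) Ω)
  have g3 := fun θ => g θ (wedge (Ω.curryLeft v) Ωh)
  have k1 := wedge_2_3 (Ω.curryLeft v) Ω
  have k2 := wedge_2_3 (Ωh.curryLeft v) Ω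
  have k3 := wedge_2_3 (Ω.curryLeft v) Ωh
  simp only [oneForm_vec, AlternatingMap.curryLeft_apply_apply, k1, k2, k3] at g1 g2 g3
  have e1 := g1 θ (K a) b c d e f
  have e2 := g1 θ a (K b) c d e f
  have e3 := g1 θ a b (K c) d e f
  have e4 := g1 θ a b c (K d) e f
  have e5 := g1 θ a b c d (K e) f
  have e6 := g1 θ a b c d e (K f)
  have e7 := g1 (θ ∘ₗ K) a b c d e f
  have e8 := g2 θ a b c d e f
  have e9 := g3 θ a b c d e f
  simp only [h1, h2, h3, LinearMap.comp_apply] at e1 e2 e3 e4 e5 e6 e7 e8 e9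
  linear_combination e1 + e2 + e3 + e4 + e5 + e6 - e7 - 2 * e8 - 3 * e9

theorem K_sq [FiniteDimensional ℂ V] (hdim : Module.finrank ℂ V = 6)
    (ε : AlternatingMap ℂ V ℂ (Fin 6)) (hε : ε ≠ 0) (Ω : AlternatingMap ℂ V ℂ (Fin 3))
    (K : V →ₗ[ℂ] V)
    (hK : ∀ (θ : V →ₗ[ℂ] ℂ) (v : V),
      wedge (oneForm θ) (wedge (Ω.curryLeft v) Ω) = θ (K v) • ε) :
    LinearMap.trace ℂ V K = 0 ∧
    (∀ v, K (K v) = ((6 : ℂ)⁻¹ * LinearMap.trace ℂ V (K ∘ₗ K)) • v) ∧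
    ∃ Ωh : AlternatingMap ℂ V ℂ (Fin 3),
      (∀ x y z, Ω ![K x, y, z] = Ωh ![x, y, z]) ∧
      (∀ x y z, Ω ![x, K y, z] = Ωh ![x, y, z]) ∧
      (∀ x y z, Ω ![x, y, K z] = Ωh ![x, y, z]) ∧
      wedge Ωh Ω = (2 * ((6 : ℂ)⁻¹ * LinearMap.trace ℂ V (K ∘ₗ K))) • ε := by
  let b : Module.Basis (Fin 6) ℂ V := Module.finBasisOfFinrankEq ℂ V hdim
  have hb : ε b ≠ 0 := (AlternatingMap.map_basis_ne_zero_iff b ε).2 hε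
  have hA1 : ∀ (Ω : AlternatingMap ℂ V ℂ (Fin 3)) (a b c : V), Ω ![a, b, c] = - Ω ![b, a, c] := by
    intro Ω a b c
    rw [← Ω.map_swap ![b, a, c] (i := 0) (j := 1) (by simp)]
    congr 1
    funext i
    fin_cases i <;> rfl
  have hA2 : ∀ (Ω : AlternatingMap ℂ V ℂ (Fin 3)) (a b c : V), Ω ![a, b, c] = - Ω ![a, c, b] := by
    intro Ω a b c
    rw [← Ω.map_swap ![a, c, b] (i := 1) (j := 2) (by simp)]
    congr 1
    funext i
    fin_cases i <;> rfl
  -- trace zero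
  have htr : LinearMap.trace ℂ V K = 0 := by
    have h1 := wedge_derivForm b ε Ω K hK LinearMap.id
    have h2 : derivForm b LinearMap.id Ω = (3 : ℂ) • Ω := by
      ext x
      have hx : x = ![x 0, x 1, x 2] := by funext i; fin_cases i <;> rfl
      rw [hx, derivForm_apply, AlternatingMap.smul_apply]
      simp only [LinearMap.id_apply, smul_eq_mul]
      have q1 := hA1 Ω (x 1) (x 0) (x 2)
      have q2 := hA1 Ω (x 2) (x 0) (x 1)
      have q3 := hA2 Ω (x 0) (x 2) (x 1)
      linear_combination -q1 + q2 - q3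
    rw [h2, wedge_smul_left, wedge_self_3, smul_zero, LinearMap.id_comp] at h1
    exact (smul_eq_zero.1 h1.symm).resolve_right hε
  have hsym := K_symm hdim ε hε Ω K hK
  have hmid : ∀ x y z, Ω ![x, K y, z] = Ω ![K x, y, z] := by
    intro x y z
    have q1 := hsym x y z
    have q2 := hsym z x y
    have q3 := hA2 Ω x (K y) z
    have q4 := hA2 Ω x z (K y)
    have q5 := hA1 Ω (K x) y z
    have q6 := hA2 Ω y (K x) z
    have q7 := hA1 Ω x z (K y)
    have q8 := hsym y z x
    linear_combination q3 - q5 + q6 - q7 + q8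
  have hlast : ∀ x y z, Ω ![x, y, K z] = Ω ![K x, y, z] := by
    intro x y z
    have q1 := hsym x y z
    have q5 := hA1 Ω (K x) y z
    have q6 := hA2 Ω y (K x) z
    linear_combination -q1 - q5 + q6
  obtain ⟨Ωh, hh⟩ : ∃ Ωh : AlternatingMap ℂ V ℂ (Fin 3), Ωh = (3 : ℂ)⁻¹ • derivForm b K Ω :=
    ⟨_, rfl⟩
  have h1 : ∀ x y z, Ω ![K x, y, z] = Ωh ![x, y, z] := by
    intro x y z
    rw [hh, AlternatingMap.smul_apply, derivForm_apply, smul_eq_mul]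
    have q1 := hA1 Ω (K y) x z
    have q2 := hA1 Ω (K z) x y
    have q3 := hA2 Ω x (K z) y
    have q4 := hmid x y z
    have q5 := hlast x y z
    linear_combination (3 : ℂ)⁻¹ * (q1 - q4 - q2 + q3 - q5)
  have h2 : ∀ x y z, Ω ![x, K y, z] = Ωh ![x, y, z] := fun x y z => (hmid x y z).trans (h1 x y z)
  have h3 : ∀ x y z, Ω ![x, y, K z] = Ωh ![x, y, z] := fun x y z => (hlast x y z).trans (h1 x y z)
  have hw : wedge Ωh Ω = (2 * ((6 : ℂ)⁻¹ * LinearMap.trace ℂ V (K ∘ₗ K))) • ε := by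
    rw [hh, wedge_smul_left, wedge_derivForm b ε Ω K hK K, smul_smul]
    congr 1
    ring
  refine ⟨htr, ?_, Ωh, h1, h2, h3, hw⟩
  intro v
  refine b.ext_elem fun i => ?_
  change b.coord i (K (K v)) = b.coord i _
  rw [map_smul, smul_eq_mul]
  generalize b.coord i = θ
  have hKb : ∀ (θ : V →ₗ[ℂ] ℂ) (v : V),
      wedge (oneForm θ) (wedge (Ω.curryLeft v) Ω) b = θ (K v) * ε b := fun θ v =>
    congrArg (fun f : AlternatingMap ℂ V ℂ (Fin 6) => f b) (hK θ v)
  have hcur : Ωh.curryLeft v = Ω.curryLeft (K v) := by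
    ext x
    have hx : x = ![x 0, x 1] := by funext i; fin_cases i <;> rfl
    rw [hx]
    exact (h1 v (x 0) (x 1)).symm
  -- the derivation identity
  have hD := deriv_expand Ω Ωh K h1 h2 h3 θ v (b 0) (b 1) (b 2) (b 3) (b 4) (b 5)
  rw [← vec_eta_6 b, hcur] at hD
  have hT := sum_update_trace b (wedge (oneForm θ) (wedge (Ω.curryLeft v) Ω)) K
  rw [htr, zero_mul, Fin.sum_univ_six] at hT
  have u0 : Function.update b 0 (K (b 0)) = ![K (b 0), b 1, b 2, b 3, b 4, b 5] := by
    funext i; fin_cases i <;> simp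
  have u1 : Function.update b 1 (K (b 1)) = ![b 0, K (b 1), b 2, b 3, b 4, b 5] := by
    funext i; fin_cases i <;> simp
  have u2 : Function.update b 2 (K (b 2)) = ![b 0, b 1, K (b 2), b 3, b 4, b 5] := by
    funext i; fin_cases i <;> simp
  have u3 : Function.update b 3 (K (b 3)) = ![b 0, b 1, b 2, K (b 3), b 4, b 5] := by
    funext i; fin_cases i <;> simp
  have u4 : Function.update b 4 (K (b 4)) = ![b 0, b 1, b 2, b 3, K (b 4), b 5] := by
    funext i; fin_cases i <;> simp
  have u5 : Function.update b 5 (K (b 5)) = ![b 0, b 1, b 2, b 3, b 4, K (b 5)] := by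
    funext i; fin_cases i <;> simp
  rw [u0, u1, u2, u3, u4, u5] at hT
  have hD2 := hT.symm.trans hD
  have e1 := hKb (θ ∘ₗ K) v
  have e2 := hKb θ (K v)
  rw [LinearMap.comp_apply] at e1
  have hC := contract_17 hdim θ Ωh Ω v b
  rw [hcur, wedge_comm_32] at hC
  have hwb : wedge Ωh Ω b = (2 * ((6 : ℂ)⁻¹ * LinearMap.trace ℂ V (K ∘ₗ K))) * ε b :=
    congrArg (fun f : AlternatingMap ℂ V ℂ (Fin 6) => f b) hw
  rw [hwb] at hC
  apply mul_right_cancel₀ hb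
  linear_combination (-1/2 : ℂ) * hC - (1/6 : ℂ) * hD2 - (1/2 : ℂ) * e2 - (1/6 : ℂ) * e1 - (1/3 : ℂ) * e2

theorem decomp_aux [FiniteDimensional ℂ V] (hdim : Module.finrank ℂ V = 6)
    (Ω Ωh : AlternatingMap ℂ V ℂ (Fin 3)) (K : V →ₗ[ℂ] V) (μ : ℂ) (hμ : μ ≠ 0)
    (htr : LinearMap.trace ℂ V K = 0) (hKK : ∀ v, K (K v) = μ ^ 2 • v)
    (h1 : ∀ x y z, Ω ![K x, y, z] = Ωh ![x, y, z])
    (h2 : ∀ x y z, Ω ![x, K y, z] = Ωh ![x, y, z])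
    (h3 : ∀ x y z, Ω ![x, y, K z] = Ωh ![x, y, z]) :
    IsDecomposable (μ ^ 2 • (μ • Ω + Ωh)) := by
  -- linearity in each slot
  have l1 : ∀ (Θ : AlternatingMap ℂ V ℂ (Fin 3)) (r s : ℂ) (a c y z : V),
      Θ ![r • a + s • c, y, z] = r * Θ ![a, y, z] + s * Θ ![c, y, z] := by
    intro Θ r s a c y z
    have h : Θ.curryLeft (r • a + s • c) = r • Θ.curryLeft a + s • Θ.curryLeft c := by
      rw [map_add, map_smul, map_smul]
    exact congrArg (fun f : AlternatingMap ℂ V ℂ (Fin 2) => f ![y, z]) h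
  have l2 : ∀ (Θ : AlternatingMap ℂ V ℂ (Fin 3)) (r s : ℂ) (a c x z : V),
      Θ ![x, r • a + s • c, z] = r * Θ ![x, a, z] + s * Θ ![x, c, z] := by
    intro Θ r s a c x z
    have h : (Θ.curryLeft x).curryLeft (r • a + s • c) =
        r • (Θ.curryLeft x).curryLeft a + s • (Θ.curryLeft x).curryLeft c := by
      rw [map_add, map_smul, map_smul]
    exact congrArg (fun f : AlternatingMap ℂ V ℂ (Fin 1) => f ![z]) h
  have l3 : ∀ (Θ : AlternatingMap ℂ V ℂ (Fin 3)) (r s : ℂ) (a c x y : V),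
      Θ ![x, y, r • a + s • c] = r * Θ ![x, y, a] + s * Θ ![x, y, c] := by
    intro Θ r s a c x y
    have h : ((Θ.curryLeft x).curryLeft y).curryLeft (r • a + s • c) =
        r • ((Θ.curryLeft x).curryLeft y).curryLeft a +
          s • ((Θ.curryLeft x).curryLeft y).curryLeft c := by
      rw [map_add, map_smul, map_smul]
    exact congrArg (fun f : AlternatingMap ℂ V ℂ (Fin 0) => f ![]) h
  obtain ⟨Q, hQ⟩ : ∃ Q : V →ₗ[ℂ] V, Q = (2 * μ)⁻¹ • K + (2⁻¹ : ℂ) • LinearMap.id := ⟨_, rfl⟩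
  have hQa : ∀ v, Q v = (2 * μ)⁻¹ • K v + (2⁻¹ : ℂ) • v := by
    intro v; rw [hQ]; rfl
  have hQQ : ∀ v, Q (Q v) = Q v := by
    intro v
    rw [hQa (Q v), hQa v, map_add, map_smul, map_smul, hKK]
    match_scalars <;> field_simp <;> ring
  obtain ⟨Ψ, hΨ⟩ : ∃ Ψ : AlternatingMap ℂ V ℂ (Fin 3), Ψ = μ • Ω + Ωh := ⟨_, rfl⟩
  have hΨa : ∀ x y z, Ψ ![x, y, z] = μ * Ω ![x, y, z] + Ωh ![x, y, z] := by
    intro x y z; rw [hΨ]; rfl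
  have k1 : ∀ x y z, Ωh ![K x, y, z] = μ ^ 2 * Ω ![x, y, z] := by
    intro x y z
    rw [← h1, hKK]
    have := l1 Ω (μ ^ 2) 0 x x y z
    rwa [zero_smul, zero_mul, add_zero, add_zero] at this
  have k2 : ∀ x y z, Ωh ![x, K y, z] = μ ^ 2 * Ω ![x, y, z] := by
    intro x y z
    rw [← h2, hKK]
    have := l2 Ω (μ ^ 2) 0 y y x z
    rwa [zero_smul, zero_mul, add_zero, add_zero] at this
  have k3 : ∀ x y z, Ωh ![x, y, K z] = μ ^ 2 * Ω ![x, y, z] := by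
    intro x y z
    rw [← h3, hKK]
    have := l3 Ω (μ ^ 2) 0 z z x y
    rwa [zero_smul, zero_mul, add_zero, add_zero] at this
  have m1 : ∀ x y z, Ψ ![Q x, y, z] = Ψ ![x, y, z] := by
    intro x y z
    rw [hQa, l1, hΨa, hΨa, h1, k1]
    field_simp
    ring
  have m2 : ∀ x y z, Ψ ![x, Q y, z] = Ψ ![x, y, z] := by
    intro x y z
    rw [hQa, l2, hΨa, hΨa, h2, k2]
    field_simp
    ring
  have m3 : ∀ x y z, Ψ ![x, y, Q z] = Ψ ![x, y, z] := by
    intro x y z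
    rw [hQa, l3, hΨa, hΨa, h3, k3]
    field_simp
    ring
  -- the range of the projection has dimension three
  have hproj : LinearMap.IsProj (LinearMap.range Q) Q := by
    refine ⟨fun x => LinearMap.mem_range_self Q x, ?_⟩
    rintro _ ⟨y, rfl⟩
    exact hQQ y
  have hrank : Module.finrank ℂ (LinearMap.range Q) = 3 := by
    have h := hproj.trace
    rw [hQ, map_add, map_smul, map_smul, htr, LinearMap.trace_id, hdim, ← hQ] at h
    have h' : ((Module.finrank ℂ (LinearMap.range Q) : ℕ) : ℂ) = (3 : ℕ) := by
      rw [← h]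
      norm_num
    exact_mod_cast h'
  let f : Module.Basis (Fin 3) ℂ (LinearMap.range Q) := Module.finBasisOfFinrankEq ℂ _ hrank
  let R : V →ₗ[ℂ] LinearMap.range Q := Q.rangeRestrict
  obtain ⟨c, hc⟩ : ∃ c : ℂ, Ψ.compLinearMap (LinearMap.range Q).subtype = c • f.det :=
    ⟨_, AlternatingMap.eq_smul_basis_det f _⟩
  refine ⟨(μ ^ 2 * c) • (f.coord 0 ∘ₗ R), f.coord 1 ∘ₗ R, f.coord 2 ∘ₗ R, ?_⟩
  rw [← hΨ]
  ext x
  have hx : x = ![x 0, x 1, x 2] := by funext i; fin_cases i <;> rfl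
  rw [hx]
  generalize x 0 = a
  generalize x 1 = b
  generalize x 2 = d
  have hdet := congrArg (fun g => g ![R a, R b, R d]) hc
  have hl : (Ψ.compLinearMap (LinearMap.range Q).subtype) ![R a, R b, R d] = Ψ ![a, b, d] := by
    rw [← m1, ← m2, ← m3]
    rw [AlternatingMap.compLinearMap_apply]
    congr 1
    funext i
    fin_cases i <;> rfl
  simp only [hl] at hdet
  rw [AlternatingMap.smul_apply, hdet, AlternatingMap.smul_apply, Module.Basis.det_apply,
    Matrix.det_fin_three]
  refine Eq.trans ?_ (wedge_1_2 (oneForm _) (wedge (oneForm _) (oneForm _)) a b d).symm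
  have w := wedge_1_1 (oneForm (f.coord 1 ∘ₗ R)) (oneForm (f.coord 2 ∘ₗ R))
  simp only [oneForm_vec, w, Module.Basis.toMatrix_apply, smul_eq_mul, LinearMap.comp_apply, LinearMap.smul_apply,
    Module.Basis.coord_apply]
  simp only [Matrix.cons_val]
  ring

end WedgeCalc

/-- For `Ω ∈ Λ³V*` (V a 6-dimensional complex vector space),
with `(K_Ω^*Ω)(v₁,v₂,v₃) = Ω(K_Ω v₁, K_Ω v₂, K_Ω v₃)`:
(i) `K_Ω^*Ω ∧ Ω = 2·λ(Ω)²·ε`, and (ii) for every `μ` with `μ² = λ(Ω)`, the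
3-form `μ³·Ω + K_Ω^*Ω` is decomposable. -/
theorem stmt3 (V : Type*) [AddCommGroup V] [Module ℂ V] [FiniteDimensional ℂ V]
    (hdim : Module.finrank ℂ V = 6)
    (ε : AlternatingMap ℂ V ℂ (Fin 6)) (hε : ε ≠ 0)
    (K : AlternatingMap ℂ V ℂ (Fin 3) → V →ₗ[ℂ] V)
    (hK : ∀ (Ω : AlternatingMap ℂ V ℂ (Fin 3)) (θ : V →ₗ[ℂ] ℂ) (v : V),
      wedge (oneForm θ) (wedge (Ω.curryLeft v) Ω) = θ (K Ω v) • ε)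
    (Ω : AlternatingMap ℂ V ℂ (Fin 3)) :
    wedge (Ω.compLinearMap (K Ω)) Ω =
        (2 * ((6 : ℂ)⁻¹ * LinearMap.trace ℂ V (K Ω ∘ₗ K Ω)) ^ 2) • ε ∧
      ∀ μ : ℂ, μ ^ 2 = (6 : ℂ)⁻¹ * LinearMap.trace ℂ V (K Ω ∘ₗ K Ω) →
        IsDecomposable (μ ^ 3 • Ω + Ω.compLinearMap (K Ω)) := by
  obtain ⟨htr, hKK, Ωh, h1, h2, h3, hw⟩ := K_sq hdim ε hε Ω (K Ω) (hK Ω)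
  generalize (6 : ℂ)⁻¹ * LinearMap.trace ℂ V (K Ω ∘ₗ K Ω) = l at hKK hw ⊢
  have hpull : Ω.compLinearMap (K Ω) = l • Ωh := by
    ext x
    have hx : x = ![x 0, x 1, x 2] := by funext i; fin_cases i <;> rfl
    rw [hx]
    generalize x 0 = a
    generalize x 1 = b
    generalize x 2 = c
    have e : (Ω.compLinearMap (K Ω)) ![a, b, c] = Ω ![K Ω a, K Ω b, K Ω c] := by
      rw [AlternatingMap.compLinearMap_apply]
      congr 1
      funext i
      fin_cases i <;> rfl
    have e2 : Ω ![K Ω (K Ω (K Ω a)), b, c] = l * Ω ![K Ω a, b, c] := by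
      rw [hKK]
      have h : Ω.curryLeft (l • K Ω a) = l • Ω.curryLeft (K Ω a) := map_smul _ _ _
      exact congrArg (fun f : AlternatingMap ℂ V ℂ (Fin 2) => f ![b, c]) h
    rw [e, AlternatingMap.smul_apply, smul_eq_mul, ← h1 a b c, ← e2,
      h3, ← h1, h2, ← h1]
  constructor
  · rw [hpull, wedge_smul_left, hw, smul_smul]
    congr 1
    ring
  · intro μ hμ
    subst hμ
    have hform : μ ^ 3 • Ω + Ω.compLinearMap (K Ω) = μ ^ 2 • (μ • Ω + Ωh) := by
      rw [hpull, smul_add, smul_smul]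
      congr 2
    rw [hform]
    by_cases h0 : μ = 0
    · refine ⟨0, 0, 0, ?_⟩
      have hz : oneForm (0 : V →ₗ[ℂ] ℂ) = 0 := by
        ext x; rfl
      have hz2 := wedge_smul_left (0 : ℂ) (0 : AlternatingMap ℂ V ℂ (Fin 1))
        (wedge (oneForm (0 : V →ₗ[ℂ] ℂ)) (oneForm (0 : V →ₗ[ℂ] ℂ)))
      rw [zero_smul, zero_smul] at hz2
      rw [h0, zero_pow two_ne_zero, zero_smul]
      rw [← hz] at hz2
      exact hz2.symm
    · exact decomp_aux hdim Ω Ωh (K Ω) μ h0 htr hKK h1 h2 h3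
end
end

section
/- For Ω ∈ Λ³W*, one has λ(Ω) > 0 if and only if there exist real decomposable 3-forms α, β ∈ Λ³W* with α ∧ β ≠ 0 and Ω = α + β. -/
open scoped TensorProduct

noncomputable section

section expansion
variable {M : Type*} [AddCommGroup M] [Module ℝ M] {m n : ℕ}

/-- The shuffle summand attached to a permutation. -/
def wterm (α : AlternatingMap ℝ M ℝ (Fin m)) (β : AlternatingMap ℝ M ℝ (Fin n))
    (v : Fin (m + n) → M) (σ : Equiv.Perm (Fin (m + n))) : ℝ :=
  ((Equiv.Perm.sign σ : ℤ) : ℝ) * (α (fun k => v (σ (Fin.castAdd n k))) *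
    β (fun k => v (σ (Fin.natAdd m k))))

/-- Transport of permutations. -/
def toSum (σ : Equiv.Perm (Fin (m + n))) : Equiv.Perm (Fin m ⊕ Fin n) :=
  finSumFinEquiv.symm.permCongr σ

theorem wedge_eq_quot (α : AlternatingMap ℝ M ℝ (Fin m)) (β : AlternatingMap ℝ M ℝ (Fin n))
    (v : Fin (m + n) → M) : ∃ T : Equiv.Perm.ModSumCongr (Fin m) (Fin n) → ℝ,
      wedge α β v = ∑ q, T q ∧
      ∀ σ, T (Quotient.mk'' (toSum σ)) = wterm α β v σ := by
  refine ⟨fun q => LinearMap.mul' ℝ ℝ (AlternatingMap.domCoprod.summand α β q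
    (fun k => v (finSumFinEquiv k))), ?_, ?_⟩
  · simp [wedge, AlternatingMap.domCoprod_apply, Function.comp_def]
  · intro σ
    simp only [AlternatingMap.domCoprod.summand_mk'', wterm, toSum]
    have hs : Equiv.Perm.sign (finSumFinEquiv.symm.permCongr σ) = Equiv.Perm.sign σ := by simp
    rw [hs]
    rcases Int.units_eq_one_or (Equiv.Perm.sign σ) with h | h <;> rw [h] <;>
      simp [MultilinearMap.domCoprod_apply]

theorem toSum_surj (q : Equiv.Perm.ModSumCongr (Fin m) (Fin n)) :
    ∃ σ : Equiv.Perm (Fin (m + n)), q = Quotient.mk'' (toSum σ) := by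
  induction q using Quotient.inductionOn' with | _ σ
  exact ⟨finSumFinEquiv.permCongr σ, by congr 1; ext x; simp [toSum]⟩

theorem toSum_rel {σ τ : Equiv.Perm (Fin (m + n))}
    (h : (Quotient.mk'' (toSum σ) : Equiv.Perm.ModSumCongr (Fin m) (Fin n)) =
      Quotient.mk'' (toSum τ)) :
    ∀ k : Fin m, ∃ k', τ (Fin.castAdd n k) = σ (Fin.castAdd n k') := by
  intro k
  obtain ⟨⟨sl, sr⟩, h⟩ := QuotientGroup.leftRel_apply.mp (Quotient.exact' h)
  have h := inv_mul_eq_iff_eq_mul.mp h.symm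
  refine ⟨sl k, ?_⟩
  have := congrArg finSumFinEquiv (Equiv.congr_fun h (Sum.inl k))
  simpa [toSum] using this

theorem wedge_eq_zero (α : AlternatingMap ℝ M ℝ (Fin m)) (β : AlternatingMap ℝ M ℝ (Fin n))
    (v : Fin (m + n) → M) (h : ∀ σ, wterm α β v σ = 0) : wedge α β v = 0 := by
  obtain ⟨T, h1, h2⟩ := wedge_eq_quot α β v
  rw [h1]
  refine Finset.sum_eq_zero fun q _ => ?_
  obtain ⟨σ, rfl⟩ := toSum_surj q
  rw [h2, h]

theorem wedge_eq_sum_s4 {N : ℕ} (g : Fin N → Equiv.Perm (Fin (m + n)))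
    (hN : N * (m.factorial * n.factorial) = (m + n).factorial)
    (hg : ∀ i j, (∀ k : Fin m, ∃ k', g j (Fin.castAdd n k) = g i (Fin.castAdd n k')) → i = j)
    (α : AlternatingMap ℝ M ℝ (Fin m)) (β : AlternatingMap ℝ M ℝ (Fin n))
    (v : Fin (m + n) → M) : wedge α β v = ∑ i, wterm α β v (g i) := by
  obtain ⟨T, h1, h2⟩ := wedge_eq_quot α β v
  rw [h1]
  have hinj : Function.Injective (fun i : Fin N =>
      (Quotient.mk'' (toSum (g i)) : Equiv.Perm.ModSumCongr (Fin m) (Fin n))) :=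
    fun i j h => hg i j (toSum_rel h)
  have hcard : Fintype.card (Fin N) = Fintype.card (Equiv.Perm.ModSumCongr (Fin m) (Fin n)) := by
    have h := Subgroup.card_eq_card_quotient_mul_card_subgroup
      (Equiv.Perm.sumCongrHom (Fin m) (Fin n)).range
    simp only [Nat.card_eq_fintype_card] at h
    rw [Equiv.Perm.sumCongrHom.card_range] at h
    simp only [Fintype.card_perm, Fintype.card_sum, Fintype.card_fin, Fintype.card_prod] at h
    rw [Fintype.card_fin]
    exact Nat.eq_of_mul_eq_mul_right (by positivity) (hN.trans h)
  have hb := (Fintype.bijective_iff_injective_and_card _).2 ⟨hinj, hcard⟩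
  have h3 : ∑ i, wterm α β v (g i) = ∑ i : Fin N, T (Quotient.mk'' (toSum (g i))) :=
    Finset.sum_congr rfl fun i _ => (h2 _).symm
  rw [h3]
  convert (hb.sum_comp T).symm

theorem wedge_eq_single (α : AlternatingMap ℝ M ℝ (Fin m)) (β : AlternatingMap ℝ M ℝ (Fin n))
    (v : Fin (m + n) → M)
    (h : ∀ σ : Equiv.Perm (Fin (m + n)), (∃ k : Fin m, ∃ k' : Fin n,
      σ (Fin.castAdd n k) = Fin.natAdd m k') → wterm α β v σ = 0) :
    wedge α β v = wterm α β v 1 := by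
  obtain ⟨T, h1, h2⟩ := wedge_eq_quot α β v
  rw [h1, ← h2, Finset.sum_eq_single]
  · intro q _ hq
    obtain ⟨σ, rfl⟩ := toSum_surj q
    rw [h2]
    apply h
    by_contra hc
    push Not at hc
    apply hq
    symm
    apply Quotient.sound'
    rw [QuotientGroup.leftRel_apply]
    apply Equiv.Perm.mem_sumCongrHom_range_of_perm_mapsTo_inl
    rintro _ ⟨k, rfl⟩
    have := hc k
    obtain ⟨y, hy⟩ := finSumFinEquiv.surjective (σ (Fin.castAdd n k))
    rcases y with y | y
    · refine ⟨y, ?_⟩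
      apply finSumFinEquiv.injective
      rw [hy]
      have h1 : (toSum 1 : Equiv.Perm (Fin m ⊕ Fin n)) = 1 := by ext x; simp [toSum]
      rw [h1]
      simp [toSum]
    · exact absurd (by simpa using hy.symm) (this y)
  · simp

theorem wedge_one (n : ℕ) (θ : M →ₗ[ℝ] ℝ) (β : AlternatingMap ℝ M ℝ (Fin n))
    (v : Fin (1 + n) → M) :
    wedge (oneForm θ) β v = ∑ i : Fin (n + 1), (-1) ^ (i : ℕ) *
      (θ (v (Fin.cast (add_comm _ _) i)) *
        β (fun k => v (Fin.cast (add_comm _ _) (i.succAbove k)))) := by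
  rw [wedge_eq_sum_s4 (N := n + 1)
    (fun i => (finCongr (add_comm n 1)).permCongr i.cycleRange.symm)]
  · refine Finset.sum_congr rfl fun i _ => ?_
    have h0 : ∀ k : Fin 1, Fin.cast (add_comm 1 n) (Fin.castAdd n k) = 0 := by
      intro k; ext; simp
    have h1 : ∀ k : Fin n, Fin.cast (add_comm 1 n) (Fin.natAdd 1 k) = k.succ := by
      intro k; ext; simp [add_comm]
    simp [wterm, oneForm, h0, h1]
  · simp [Nat.factorial_succ, add_comm]
  · intro i j h
    have h0 : ∀ k : Fin 1, Fin.cast (add_comm 1 n) (Fin.castAdd n k) = 0 := by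
      intro k; ext; simp
    obtain ⟨k', hk⟩ := h 0
    simp only [Equiv.permCongr_apply, finCongr_symm, finCongr_apply, h0,
      Fin.cycleRange_symm_zero] at hk
    exact (Fin.cast_injective _ hk).symm

/-- The ten (2,3)-shuffles. -/
def g23 : Fin 10 → Equiv.Perm (Fin (2 + 3)) :=
  ![1, Equiv.swap 1 2, Equiv.swap 1 3, Equiv.swap 1 4, Equiv.swap 0 2, Equiv.swap 0 3,
    Equiv.swap 0 4, Equiv.swap 0 2 * Equiv.swap 1 3, Equiv.swap 0 2 * Equiv.swap 1 4,
    Equiv.swap 0 3 * Equiv.swap 1 4]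

theorem wedge_23 (α : AlternatingMap ℝ M ℝ (Fin 2)) (β : AlternatingMap ℝ M ℝ (Fin 3))
    (v : Fin 5 → M) :
    wedge α β v = 
      α ![v 0, v 1] * β ![v 2, v 3, v 4] - α ![v 0, v 2] * β ![v 1, v 3, v 4]
      - α ![v 0, v 3] * β ![v 2, v 1, v 4] - α ![v 0, v 4] * β ![v 2, v 3, v 1]
      - α ![v 2, v 1] * β ![v 0, v 3, v 4] - α ![v 3, v 1] * β ![v 2, v 0, v 4]
      - α ![v 4, v 1] * β ![v 2, v 3, v 0] + α ![v 2, v 3] * β ![v 0, v 1, v 4]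
      + α ![v 2, v 4] * β ![v 0, v 3, v 1] + α ![v 3, v 4] * β ![v 2, v 0, v 1] := by
  rw [wedge_eq_sum_s4 g23 (by decide) (by decide)]
  have e2 : ∀ f : Fin 2 → M, f = ![f 0, f 1] := fun f => by ext i; fin_cases i <;> rfl
  have e3 : ∀ f : Fin 3 → M, f = ![f 0, f 1, f 2] := fun f => by ext i; fin_cases i <;> rfl
  have key : ∀ (i : Fin 10) (s : ℤˣ) (a b c d e : Fin 5), Equiv.Perm.sign (g23 i) = s →
      g23 i 0 = a → g23 i 1 = b → g23 i 2 = c → g23 i 3 = d → g23 i 4 = e →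
      wterm α β v (g23 i) = ((s : ℤ) : ℝ) * (α ![v a, v b] * β ![v c, v d, v e]) := by
    rintro i s a b c d e rfl rfl rfl rfl rfl rfl
    rw [wterm, e2 (fun k => _), e3 (fun k => _)]
    rfl
  have d : ∀ (i : Fin 10) (s : ℤˣ) (a b c d e : Fin 5), Equiv.Perm.sign (g23 i) = s ∧
      g23 i 0 = a ∧ g23 i 1 = b ∧ g23 i 2 = c ∧ g23 i 3 = d ∧ g23 i 4 = e →
      wterm α β v (g23 i) = ((s : ℤ) : ℝ) * (α ![v a, v b] * β ![v c, v d, v e]) :=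
    fun i s a b c d e h => key i s a b c d e h.1 h.2.1 h.2.2.1 h.2.2.2.1 h.2.2.2.2.1 h.2.2.2.2.2
  have hs : ∀ f : Fin 10 → ℝ, ∑ i, f i =
      f 0 + f 1 + f 2 + f 3 + f 4 + f 5 + f 6 + f 7 + f 8 + f 9 := by
    intro f
    rw [Fin.sum_univ_castSucc, Fin.sum_univ_castSucc, Fin.sum_univ_eight]
    rfl
  rw [hs]
  rw [d 0 1 0 1 2 3 4 (by decide),
    d 1 (-1) 0 2 1 3 4 (by decide),
    d 2 (-1) 0 3 2 1 4 (by decide),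
    d 3 (-1) 0 4 2 3 1 (by decide),
    d 4 (-1) 2 1 0 3 4 (by decide),
    d 5 (-1) 3 1 2 0 4 (by decide),
    d 6 (-1) 4 1 2 3 0 (by decide),
    d 7 1 2 3 0 1 4 (by decide),
    d 8 1 2 4 0 3 1 (by decide),
    d 9 1 3 4 2 0 1 (by decide)]
  push_cast
  ring
end expansion

/-- The ten-term expansion of a 2-form wedge a 3-form in coordinates. -/
def Q23 (A : Fin 6 → Fin 6 → Fin 6 → ℝ) (j p q r s t : Fin 6) : ℝ :=
  A j p q * A r s t - A j p r * A q s t - A j p s * A r q t - A j p t * A r s q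
  - A j r q * A p s t - A j s q * A r p t - A j t q * A r s p + A j r s * A p q t
  + A j r t * A p s q + A j s t * A r p q

/-- Coordinates of the endomorphism. -/
def kap (A : Fin 6 → Fin 6 → Fin 6 → ℝ) (i j : Fin 6) : ℝ :=
  ![Q23 A j 1 2 3 4 5, - Q23 A j 0 2 3 4 5, Q23 A j 0 1 3 4 5, - Q23 A j 0 1 2 4 5,
    Q23 A j 0 1 2 3 5, - Q23 A j 0 1 2 3 4] i

section coords
variable {A : Fin 6 → Fin 6 → Fin 6 → ℝ}

theorem srt (h1 : ∀ i j k, A i j k = - A j i k) (h2 : ∀ i j k, A i j k = - A i k j) :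
    (∀ i j k, j < i → A i j k = - A j i k) ∧ (∀ i j k, k < j → A i j k = - A i k j) ∧
    (∀ i k, A i i k = 0) ∧ (∀ i k, A i k k = 0) := 
  ⟨fun i j k _ => h1 i j k, fun i j k _ => h2 i j k, fun i k => by linarith [h1 i i k],
    fun i k => by linarith [h2 i k k]⟩

theorem poly1_s4 (h1 : ∀ i j k, A i j k = - A j i k) (h2 : ∀ i j k, A i j k = - A i k j) :
    ∑ m, kap A m 0 * A m 0 1 = 0 := by
  obtain ⟨s1, s2, s3, s4⟩ := srt h1 h2
  simp only [Fin.sum_univ_six, kap, Q23, Matrix.cons_val]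
  simp (discharger := decide) only [s1, s2, s3, s4]
  ring

theorem poly2_s4 (h1 : ∀ i j k, A i j k = - A j i k) (h2 : ∀ i j k, A i j k = - A i k j) :
    ∑ m, kap A 1 m * kap A m 0 = 0 := by
  obtain ⟨s1, s2, s3, s4⟩ := srt h1 h2
  simp only [Fin.sum_univ_six, kap, Q23, Matrix.cons_val]
  simp (discharger := decide) only [s1, s2, s3, s4]
  ring

theorem poly3_s4 (h1 : ∀ i j k, A i j k = - A j i k) (h2 : ∀ i j k, A i j k = - A i k j) :
    ∑ m, kap A m m = 0 := by
  obtain ⟨s1, s2, s3, s4⟩ := srt h1 h2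
  simp only [Fin.sum_univ_six, kap, Q23, Matrix.cons_val]
  simp (discharger := decide) only [s1, s2, s3, s4]
  ring

theorem poly4 (h1 : ∀ i j k, A i j k = - A j i k) (h2 : ∀ i j k, A i j k = - A i k j)
    (h : ∀ i j k, i < j → j < k → (i, j, k) ≠ (0, 1, 2) → (i, j, k) ≠ (3, 4, 5) →
    A i j k = 0) (i j : Fin 6) : kap A i j =
      if i = j then (if i < 3 then A 0 1 2 * A 3 4 5 else - (A 0 1 2 * A 3 4 5)) else 0 := by
  obtain ⟨s1, s2, s3, s4⟩ := srt h1 h2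
  fin_cases i <;> fin_cases j <;> 
  simp only [Fin.zero_eta, Fin.mk_one, Fin.reduceFinMk, kap, Q23, Matrix.cons_val] <;>
  simp (discharger := decide) only [s1, s2, s3, s4, h] <;> simp [mul_comm]
end coords

section decomp
variable {M : Type*} [AddCommGroup M] [Module ℝ M]

theorem dec3 (ξ η ζ : M →ₗ[ℝ] ℝ) (v : Fin 3 → M) :
    wedge (oneForm ξ) (wedge (oneForm η) (oneForm ζ)) v =
      ξ (v 0) * (η (v 1) * ζ (v 2) - η (v 2) * ζ (v 1))
      - ξ (v 1) * (η (v 0) * ζ (v 2) - η (v 2) * ζ (v 0))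
      + ξ (v 2) * (η (v 0) * ζ (v 1) - η (v 1) * ζ (v 0)) := by
  have h2 : ∀ w : Fin 2 → M, wedge (oneForm η) (oneForm ζ) w =
      η (w 0) * ζ (w 1) - η (w 1) * ζ (w 0) := by
    intro w
    refine (wedge_one 1 η (oneForm ζ) w).trans ((Fin.sum_univ_two _).trans ?_)
    change (-1) ^ 0 * (η (w 0) * ζ (w 1)) + (-1) ^ 1 * (η (w 1) * ζ (w 0)) = _
    ring
  refine (wedge_one 2 ξ (wedge (oneForm η) (oneForm ζ)) v).trans
    ((Fin.sum_univ_three _).trans ?_)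
  rw [h2, h2, h2]
  change (-1) ^ 0 * (ξ (v 0) * (η (v 1) * ζ (v 2) - η (v 2) * ζ (v 1)))
    + (-1) ^ 1 * (ξ (v 1) * (η (v 0) * ζ (v 2) - η (v 2) * ζ (v 0)))
    + (-1) ^ 2 * (ξ (v 2) * (η (v 0) * ζ (v 1) - η (v 1) * ζ (v 0))) = _
  ring

theorem dec3_zero (ξ η ζ : M →ₗ[ℝ] ℝ) (v : Fin 3 → M) (k : Fin 3)
    (h1 : ξ (v k) = 0) (h2 : η (v k) = 0) (h3 : ζ (v k) = 0) :
    wedge (oneForm ξ) (wedge (oneForm η) (oneForm ζ)) v = 0 := by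
  rw [dec3]
  fin_cases k <;> simp at h1 h2 h3 <;> simp [h1, h2, h3]

theorem exists_basis [FiniteDimensional ℝ M] {m n : ℕ} (hd : Module.finrank ℝ M = m + n)
    (v : Fin m → M) (hv : LinearIndependent ℝ v) :
    ∃ b : Module.Basis (Fin (m + n)) ℝ M, ∀ i, b (Fin.castAdd n i) = v i := by
  let B := Module.Basis.sumExtend hv
  have hf : Finite (Fin m ⊕ Module.Basis.sumExtendIndex hv) := Module.Finite.finite_basis B
  have hf2 : Finite (Module.Basis.sumExtendIndex hv) := Finite.sum_right (Fin m)
  have hc := Module.finrank_eq_nat_card_basis B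
  rw [Nat.card_sum, hd, Nat.card_fin] at hc
  have hc' : Nat.card (Module.Basis.sumExtendIndex hv) = n := by omega
  let e : Module.Basis.sumExtendIndex hv ≃ Fin n := Finite.equivFinOfCardEq hc'
  refine ⟨B.reindex ((Equiv.sumCongr (Equiv.refl _) e).trans finSumFinEquiv), fun i => ?_⟩
  simp only [Module.Basis.coe_reindex, Function.comp_apply,
    Equiv.symm_trans_apply, finSumFinEquiv_symm_apply_castAdd, Equiv.sumCongr_symm,
    Equiv.sumCongr_apply, Sum.map_inl, Equiv.refl_symm, Equiv.refl_apply]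
  simp only [B, Module.Basis.sumExtend, Module.Basis.coe_reindex, Function.comp_apply,
    Module.Basis.extend_apply_self]
  rfl

theorem alt1 (Ω : AlternatingMap ℝ M ℝ (Fin 3)) (x y z : M) :
    Ω ![x, y, z] = - Ω ![y, x, z] := by
  have h := Ω.map_swap ![y, x, z] (i := 0) (j := 1) (by decide)
  rw [← h]; congr 1; ext i; fin_cases i <;> rfl

theorem alt2 (Ω : AlternatingMap ℝ M ℝ (Fin 3)) (x y z : M) :
    Ω ![x, y, z] = - Ω ![x, z, y] := by
  have h := Ω.map_swap ![x, z, y] (i := 1) (j := 2) (by decide)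
  rw [← h]; congr 1; ext i; fin_cases i <;> rfl

theorem eq_of_sorted (b : Module.Basis (Fin 6) ℝ M) (Ω Ψ : AlternatingMap ℝ M ℝ (Fin 3))
    (h : ∀ i j k, i < j → j < k → Ω ![b i, b j, b k] = Ψ ![b i, b j, b k]) : Ω = Ψ := by
  have key : ∀ i j k, Ω ![b i, b j, b k] - Ψ ![b i, b j, b k] = 0 := by
    have h1 := fun i j k => alt1 (Ω - Ψ) (b i) (b j) (b k)
    have h2 := fun i j k => alt2 (Ω - Ψ) (b i) (b j) (b k)
    have h : ∀ i j k, i < j → j < k → (Ω - Ψ) ![b i, b j, b k] = 0 := fun i j k hi hj => by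
      rw [AlternatingMap.sub_apply, h i j k hi hj, sub_self]
    suffices h3 : ∀ i j k, (Ω - Ψ) ![b i, b j, b k] = 0 from h3
    generalize hA : (fun i j k => (Ω - Ψ) ![b i, b j, b k]) = A
    have hA' : ∀ i j k, (Ω - Ψ) ![b i, b j, b k] = A i j k := fun i j k => by rw [← hA]
    simp only [hA'] at h1 h2 h ⊢
    have h4 : ∀ i k, A i i k = 0 := fun i k => by linarith [h1 i i k]
    have h5 : ∀ i k, A i k k = 0 := fun i k => by linarith [h2 i k k]
    have h6 : ∀ i k, A i k i = 0 := fun i k => by linarith [h2 i k i, h4 i k]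
    have h7 : ∀ i j k, i < j → A i j k = 0 := by
      intro i j k hij
      rcases lt_trichotomy j k with hjk | rfl | hjk
      · exact h i j k hij hjk
      · exact h5 _ _
      · rcases lt_trichotomy i k with hik | rfl | hik
        · rw [h2, h i k j hik hjk, neg_zero]
        · exact h6 _ _
        · rw [h2, h1, h k i j hik hij, neg_zero, neg_zero]
    intro i j k
    rcases lt_trichotomy i j with hij | rfl | hij
    · exact h7 i j k hij
    · exact h4 _ _
    · rw [h1, h7 j i k hij, neg_zero]
  refine Module.Basis.ext_alternating b fun v _ => ?_
  have e : (fun i => b (v i)) = ![b (v 0), b (v 1), b (v 2)] := by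
    ext i; fin_cases i <;> rfl
  rw [e]
  exact sub_eq_zero.1 (key _ _ _)

theorem sorted_cases (i j k : Fin 6) (hij : i < j) (hjk : j < k) :
    (i = 0 ∧ j = 1 ∧ k = 2) ∨ (i = 3 ∧ j = 4 ∧ k = 5) ∨ (i < 3 ∧ 3 ≤ k) := by
  revert i j k; decide

theorem model (b : Module.Basis (Fin 6) ℝ M) (ξ : Fin 6 → M →ₗ[ℝ] ℝ)
    (hξ : ∀ i j, ξ i (b j) = if i = j then 1 else 0) (s t : ℝ)
    (α β : AlternatingMap ℝ M ℝ (Fin 3))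
    (hα : α = wedge (oneForm (s • ξ 0)) (wedge (oneForm (ξ 1)) (oneForm (ξ 2))))
    (hβ : β = wedge (oneForm (t • ξ 3)) (wedge (oneForm (ξ 4)) (oneForm (ξ 5)))) :
    α ![b 0, b 1, b 2] = s ∧ β ![b 3, b 4, b 5] = t ∧
    (∀ (f : Fin 3 → M) (k : Fin 3) (l : Fin 6), f k = b l → 3 ≤ l → α f = 0) ∧
    (∀ (f : Fin 3 → M) (k : Fin 3) (l : Fin 6), f k = b l → l < 3 → β f = 0) := by
  subst hα hβ
  refine ⟨?_, ?_, ?_, ?_⟩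
  · rw [dec3]; simp [hξ]
  · rw [dec3]; simp [hξ]
  · intro f k l h hl
    apply dec3_zero _ _ _ _ k <;> simp [h, hξ] <;> grind
  · intro f k l h hl
    apply dec3_zero _ _ _ _ k <;> simp [h, hξ] <;> grind

theorem model_sorted (b : Module.Basis (Fin 6) ℝ M) (α β : AlternatingMap ℝ M ℝ (Fin 3))
    (hα : ∀ (f : Fin 3 → M) (k : Fin 3) (l : Fin 6), f k = b l → 3 ≤ l → α f = 0)
    (hβ : ∀ (f : Fin 3 → M) (k : Fin 3) (l : Fin 6), f k = b l → l < 3 → β f = 0)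
    (i j k : Fin 6) (hi : i < 3) (hk : 3 ≤ k) : (α + β) ![b i, b j, b k] = 0 := by
  rw [AlternatingMap.add_apply, hα _ 2 k rfl hk, hβ _ 0 i rfl hi, add_zero]

end decomp

section main
variable {W : Type*} [AddCommGroup W] [Module ℝ W]
  {ε : AlternatingMap ℝ W ℝ (Fin 6)} {F : W →ₗ[ℝ] W} {Ω : AlternatingMap ℝ W ℝ (Fin 3)}

theorem wedge_15 (θ : W →ₗ[ℝ] ℝ) (β : AlternatingMap ℝ W ℝ (Fin 5)) (v : Fin 6 → W) :
    wedge (m := 1) (n := 5) (oneForm θ) β v = ∑ i : Fin 6, (-1) ^ (i : ℕ) *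
      (θ (v i) * β (fun k => v (i.succAbove k))) := wedge_one 5 θ β v

theorem kap_eq (Ω : AlternatingMap ℝ W ℝ (Fin 3)) (β : AlternatingMap ℝ W ℝ (Fin 5))
    (v : Fin 6 → W) (i j : Fin 6)
    (hβ : β = wedge (m := 2) (n := 3) (Ω.curryLeft (v j)) Ω) :
    (-1) ^ (i : ℕ) * β (fun k => v (i.succAbove k)) =
      kap (fun i j k => Ω ![v i, v j, v k]) i j := by
  have h5 : ∀ w : Fin 5 → W, β w = _ := fun w =>
    (congrArg (fun f => f w) hβ).trans (wedge_23 (Ω.curryLeft (v j)) Ω w)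
  rw [h5]
  fin_cases i <;> simp [kap, Q23, Fin.succAbove, AlternatingMap.curryLeft_apply_apply] <;> ring

theorem entry
    (hF : ∀ (θ : W →ₗ[ℝ] ℝ) (v : W),
      wedge (oneForm θ) (wedge (Ω.curryLeft v) Ω) = θ (F v) • ε)
    (b : Module.Basis (Fin 6) ℝ W) (i j : Fin 6) :
    ε b * b.repr (F (b j)) i = kap (fun i j k => Ω ![b i, b j, b k]) i j := by
  obtain ⟨β, hβ⟩ : ∃ β : AlternatingMap ℝ W ℝ (Fin 5),
    β = wedge (m := 2) (n := 3) (Ω.curryLeft (b j)) Ω := ⟨_, rfl⟩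
  have h0 := hF (b.coord i) (b j)
  have h1 : wedge (m := 1) (n := 5) (oneForm (b.coord i)) β = b.coord i (F (b j)) • ε := by
    rw [hβ]; exact h0
  have h2 := wedge_15 (b.coord i) β b
  have h3 : wedge (m := 1) (n := 5) (oneForm (b.coord i)) β (b : Fin 6 → W) =
      b.coord i (F (b j)) * ε b := by
    rw [h1]; rfl
  rw [h3] at h2
  rw [← kap_eq Ω β b i j hβ, mul_comm, ← Module.Basis.coord_apply, h2, Finset.sum_eq_single i]
  · rw [Module.Basis.coord_apply, Module.Basis.repr_self, Finsupp.single_eq_same, one_mul]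
  · intro m _ hm
    rw [Module.Basis.coord_apply, Module.Basis.repr_self, Finsupp.single_eq_of_ne (Ne.symm hm),
      zero_mul, mul_zero]
  · simp

theorem entry2
    (hF : ∀ (θ : W →ₗ[ℝ] ℝ) (v : W),
      wedge (oneForm θ) (wedge (Ω.curryLeft v) Ω) = θ (F v) • ε)
    (b : Module.Basis (Fin 6) ℝ W) (i j : Fin 6) :
    ε b * ε b * b.repr (F (F (b j))) i =
      ∑ m, kap (fun i j k => Ω ![b i, b j, b k]) i m *
        kap (fun i j k => Ω ![b i, b j, b k]) m j := by
  conv_lhs => rw [← b.sum_repr (F (b j))]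
  simp only [map_sum, map_smul, Finsupp.coe_finsetSum, Finset.sum_apply, Finsupp.smul_apply,
    smul_eq_mul, Finset.mul_sum]
  refine Finset.sum_congr rfl fun m _ => ?_
  rw [← entry hF b i m, ← entry hF b m j]
  ring

theorem trace_basis (b : Module.Basis (Fin 6) ℝ W) (G : W →ₗ[ℝ] W) :
    LinearMap.trace ℝ W G = ∑ i, b.repr (G (b i)) i := by
  rw [LinearMap.trace_eq_matrix_trace ℝ b, Matrix.trace]
  simp [LinearMap.toMatrix_apply]

variable [FiniteDimensional ℝ W]

theorem symF1 (hdim : Module.finrank ℝ W = 6) (hε : ε ≠ 0)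
    (hF : ∀ (θ : W →ₗ[ℝ] ℝ) (v : W),
      wedge (oneForm θ) (wedge (Ω.curryLeft v) Ω) = θ (F v) • ε) (x z : W) :
    Ω ![F x, x, z] = 0 := by
  by_cases hl : LinearIndependent ℝ ![x, z]
  · obtain ⟨b, hb⟩ := exists_basis (m := 2) (n := 4) hdim _ hl
    have hb0 : b 0 = x := hb 0
    have hb1 : b 1 = z := hb 1
    have hc : ε b ≠ 0 := (AlternatingMap.map_basis_ne_zero_iff b ε).2 hε
    have hp := poly1_s4 (A := fun i j k => Ω ![b i, b j, b k])
      (fun i j k => alt1 Ω _ _ _) (fun i j k => alt2 Ω _ _ _)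
    have hlin : Ω ![F x, x, z] = ∑ m, b.repr (F (b 0)) m * Ω ![b m, b 0, b 1] := by
      let L : W →ₗ[ℝ] ℝ :=
        { toFun := fun y => Ω ![y, b 0, b 1]
          map_add' := fun p q =>
            congrArg (fun f => f ![b 0, b 1]) (Ω.curryLeft.map_add p q)
          map_smul' := fun a p =>
            congrArg (fun f => f ![b 0, b 1]) (Ω.curryLeft.map_smul a p) }
      have h := congrArg L (b.sum_repr (F (b 0)))
      simp only [map_sum, map_smul, smul_eq_mul] at h
      rw [← hb0, ← hb1]
      exact h.symm
    have : ε b * Ω ![F x, x, z] = 0 := by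
      rw [hlin, ← hp, Finset.mul_sum]
      refine Finset.sum_congr rfl fun m _ => ?_
      rw [← entry hF b m 0]
      ring
    exact (mul_eq_zero.1 this).resolve_left hc
  · have h0 : ¬ LinearIndependent ℝ ![F x, x, z] := by
      intro h
      apply hl
      have := h.comp (Fin.succ : Fin 2 → Fin 3) (Fin.succ_injective _)
      convert this using 1
      ext i; fin_cases i <;> rfl
    exact Ω.map_linearDependent _ h0

theorem symF2 (hdim : Module.finrank ℝ W = 6) (hε : ε ≠ 0)
    (hF : ∀ (θ : W →ₗ[ℝ] ℝ) (v : W),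
      wedge (oneForm θ) (wedge (Ω.curryLeft v) Ω) = θ (F v) • ε) (x y z : W) {μ : ℝ} (hμ : μ ≠ 0)
    (hx : F x = μ • x) (hy : F y = - (μ • y)) :
    Ω ![x, y, z] = 0 := by
  have hadd : ∀ p q r s : W, Ω ![p + q, r, s] = Ω ![p, r, s] + Ω ![q, r, s] := by
    intro p q r s
    exact congrArg (fun f => f ![r, s]) (Ω.curryLeft.map_add p q)
  have hsmul : ∀ (a : ℝ) (p r s : W), Ω ![a • p, r, s] = a * Ω ![p, r, s] := by
    intro a p r s
    exact congrArg (fun f => f ![r, s]) (Ω.curryLeft.map_smul a p)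
  have h := symF1 hdim hε hF (x + y) z
  have h1 := symF1 hdim hε hF x z
  have h2 := symF1 hdim hε hF y z
  rw [map_add, hadd, alt1 Ω (F x), alt1 Ω (F y), hadd, hadd, alt1 Ω x (F x), alt1 Ω y (F x),
    alt1 Ω x (F y), alt1 Ω y (F y), h1, h2, hx, hy, ← neg_smul, hsmul, hsmul, alt1 Ω y x] at h
  have : μ * Ω ![x, y, z] = 0 := by linarith
  exact (mul_eq_zero.1 this).resolve_left hμ

theorem sqF (hdim : Module.finrank ℝ W = 6) (hε : ε ≠ 0)
    (hF : ∀ (θ : W →ₗ[ℝ] ℝ) (v : W),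
      wedge (oneForm θ) (wedge (Ω.curryLeft v) Ω) = θ (F v) • ε) :
    ∃ r : ℝ, F ∘ₗ F = r • 1 := by
  apply LinearMap.exists_eq_smul_id_of_forall_notLinearIndependent
  intro x hl
  obtain ⟨b, hb⟩ := exists_basis (m := 2) (n := 4) hdim _ hl
  have hb0 : b 0 = x := hb 0
  have hb1 : b 1 = F (F x) := hb 1
  have hc : ε b ≠ 0 := (AlternatingMap.map_basis_ne_zero_iff b ε).2 hε
  have hp := poly2_s4 (A := fun i j k => Ω ![b i, b j, b k])
      (fun i j k => alt1 Ω _ _ _) (fun i j k => alt2 Ω _ _ _)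
  rw [← entry2 hF b 1 0, hb0, ← hb1, Module.Basis.repr_self] at hp
  simp [hc] at hp

theorem traceF (hdim : Module.finrank ℝ W = 6) (hε : ε ≠ 0)
    (hF : ∀ (θ : W →ₗ[ℝ] ℝ) (v : W),
      wedge (oneForm θ) (wedge (Ω.curryLeft v) Ω) = θ (F v) • ε) :
    LinearMap.trace ℝ W F = 0 := by
  let b : Module.Basis (Fin 6) ℝ W := Module.finBasisOfFinrankEq ℝ W hdim
  have hc : ε b ≠ 0 := (AlternatingMap.map_basis_ne_zero_iff b ε).2 hε
  have hp := poly3_s4 (A := fun i j k => Ω ![b i, b j, b k])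
      (fun i j k => alt1 Ω _ _ _) (fun i j k => alt2 Ω _ _ _)
  simp only [← entry hF b] at hp
  rw [← Finset.mul_sum, ← trace_basis] at hp
  exact (mul_eq_zero.1 hp).resolve_left hc

theorem eigenbasis (hdim : Module.finrank ℝ W = 6) {μ : ℝ} (hμ : μ ≠ 0)
    (hsq : ∀ x, F (F x) = (μ * μ) • x) (htr : LinearMap.trace ℝ W F = 0) :
    ∃ b : Module.Basis (Fin 6) ℝ W, (∀ i, i < 3 → F (b i) = μ • b i) ∧
      ∀ i, 3 ≤ i → F (b i) = - (μ • b i) := by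
  let P : W →ₗ[ℝ] W := (2⁻¹ : ℝ) • (LinearMap.id + μ⁻¹ • F)
  have hP : ∀ x, P x = (2⁻¹ : ℝ) • (x + μ⁻¹ • F x) := fun x => rfl
  let p : Submodule ℝ W := LinearMap.ker (F - μ • LinearMap.id)
  have hp : ∀ x, x ∈ p ↔ F x = μ • x := fun x => by
    simp [p, LinearMap.mem_ker, sub_eq_zero]
  have hproj : LinearMap.IsProj p P := by
    constructor
    · intro x
      rw [hp, hP, map_smul, map_add, map_smul, hsq]
      simp only [smul_add, smul_smul]
      rw [add_comm]
      congr 2 <;> field_simp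
    · intro x hx
      rw [hp] at hx
      rw [hP, hx, smul_smul, inv_mul_cancel₀ hμ, one_smul, ← two_smul ℝ x, smul_smul]
      norm_num
  have hker : ∀ x, x ∈ LinearMap.ker P → F x = - (μ • x) := by
    intro x hx
    rw [LinearMap.mem_ker, hP, smul_eq_zero] at hx
    have hx := hx.resolve_left (by norm_num)
    have : F x = μ • (μ⁻¹ • F x) := by rw [smul_smul, mul_inv_cancel₀ hμ, one_smul]
    rw [this, ← smul_neg, eq_neg_of_add_eq_zero_right hx]
  have hcompl := hproj.isCompl
  have ht := hproj.trace
  have ht2 : LinearMap.trace ℝ W P = 3 := by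
    simp only [P, map_smul, map_add, htr, LinearMap.trace_id, hdim]
    norm_num
  have h3 : Module.finrank ℝ p = 3 := by
    rw [ht2] at ht; exact_mod_cast ht.symm
  have h3' : Module.finrank ℝ (LinearMap.ker P) = 3 := by
    have := Submodule.finrank_add_eq_of_isCompl hcompl
    omega
  let bp := Module.finBasisOfFinrankEq ℝ p h3
  let bq := Module.finBasisOfFinrankEq ℝ (LinearMap.ker P) h3'
  let b : Module.Basis (Fin (3 + 3)) ℝ W :=
    ((bp.prod bq).map (Submodule.prodEquivOfIsCompl _ _ hcompl)).reindex finSumFinEquiv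
  have hb1 : ∀ k : Fin 3, b (Fin.castAdd 3 k) = bp k := by
    intro k
    simp only [b, Module.Basis.coe_reindex, Function.comp_apply,
      finSumFinEquiv_symm_apply_castAdd]
    simp
  have hb2 : ∀ k : Fin 3, b (Fin.natAdd 3 k) = bq k := by
    intro k
    simp only [b, Module.Basis.coe_reindex, Function.comp_apply,
      finSumFinEquiv_symm_apply_natAdd]
    simp
  refine ⟨b, fun i hi => ?_, fun i hi => ?_⟩
  · have : i = Fin.castAdd 3 (⟨i, hi⟩ : Fin 3) := rfl
    rw [this, hb1]
    exact (hp _).1 (bp _).2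
  · have : i = Fin.natAdd 3 (⟨i - 3, by omega⟩ : Fin 3) := by
      ext; simp; have : 3 ≤ (i : ℕ) := hi; omega
    rw [this, hb2]
    exact hker _ (bq _).2

theorem wedge_zero_basis {m n : ℕ} (b : Module.Basis (Fin (m + n)) ℝ W)
    (α : AlternatingMap ℝ W ℝ (Fin m)) (β : AlternatingMap ℝ W ℝ (Fin n))
    (h : ∀ σ, wterm α β b σ = 0) : wedge α β = 0 := by
  by_contra hw
  exact (AlternatingMap.map_basis_ne_zero_iff b (wedge α β)).2 hw (wedge_eq_zero α β b h)

theorem backward (hdim : Module.finrank ℝ W = 6) (hε : ε ≠ 0)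
    (hF : ∀ (θ : W →ₗ[ℝ] ℝ) (v : W),
      wedge (oneForm θ) (wedge (Ω.curryLeft v) Ω) = θ (F v) • ε)
    (α β : AlternatingMap ℝ W ℝ (Fin 3)) (hα : IsDecomposable α) (hβ : IsDecomposable β)
    (hw : wedge α β ≠ 0) (hΩ : Ω = α + β) : 0 < LinearMap.trace ℝ W (F ∘ₗ F) := by
  obtain ⟨ξ₀, ξ₁, ξ₂, hα⟩ := hα
  obtain ⟨ξ₃, ξ₄, ξ₅, hβ⟩ := hβ
  let ξ : Fin 6 → W →ₗ[ℝ] ℝ := ![ξ₀, ξ₁, ξ₂, ξ₃, ξ₄, ξ₅]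
  have hinj : ∀ x, (∀ i, ξ i x = 0) → x = 0 := by
    intro x hx
    by_contra hx0
    have hl : LinearIndependent ℝ ![x] := by simpa [linearIndependent_unique_iff] using hx0
    obtain ⟨b, hb0⟩ : ∃ b : Module.Basis (Fin (3 + 3)) ℝ W, b 0 = x := by
      obtain ⟨b, hb⟩ := exists_basis (m := 1) (n := 5) hdim _ hl
      exact ⟨b, hb 0⟩
    refine hw (wedge_zero_basis b α β ?_)
    intro σ
    obtain ⟨y, hy⟩ := (finSumFinEquiv (m := 3) (n := 3)).surjective (σ.symm 0)
    rcases y with k | k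
    · have hk : σ (Fin.castAdd 3 k) = 0 := by
        rw [finSumFinEquiv_apply_left] at hy; rw [hy]; simp
      have h0 : b (σ (Fin.castAdd 3 k)) = x := by rw [hk]; exact hb0
      have : α (fun k => b (σ (Fin.castAdd 3 k))) = 0 := by
        rw [hα]
        exact dec3_zero _ _ _ _ k (by rw [h0]; exact hx 0) (by rw [h0]; exact hx 1)
          (by rw [h0]; exact hx 2)
      rw [wterm, this]; simp
    · have hk : σ (Fin.natAdd 3 k) = 0 := by
        rw [finSumFinEquiv_apply_right] at hy; rw [hy]; simp
      have h0 : b (σ (Fin.natAdd 3 k)) = x := by rw [hk]; exact hb0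
      have : β (fun k => b (σ (Fin.natAdd 3 k))) = 0 := by
        rw [hβ]
        exact dec3_zero _ _ _ _ k (by rw [h0]; exact hx 3) (by rw [h0]; exact hx 4)
          (by rw [h0]; exact hx 5)
      rw [wterm, this]; simp
  let L : W →ₗ[ℝ] (Fin 6 → ℝ) := LinearMap.pi ξ
  have hL : Function.Injective L := by
    rw [← LinearMap.ker_eq_bot, LinearMap.ker_eq_bot']
    intro x hx
    exact hinj x fun i => congrFun hx i
  let e : W ≃ₗ[ℝ] (Fin 6 → ℝ) := LinearEquiv.ofInjectiveOfFinrankEq L hL (by simp [hdim])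
  let b := Module.Basis.ofEquivFun e
  have hξ : ∀ i j, ξ i (b j) = if i = j then 1 else 0 := by
    intro i j
    have h1 : ξ i (b j) = e (b j) i := rfl
    rw [h1]
    simp [b, Pi.single_apply]
  obtain ⟨m1, m2, m3, m4⟩ := model b ξ hξ 1 1 α β (by rw [one_smul]; exact hα)
    (by rw [one_smul]; exact hβ)
  have hc : ε b ≠ 0 := (AlternatingMap.map_basis_ne_zero_iff b ε).2 hε
  have hp := poly4 (A := fun i j k => Ω ![b i, b j, b k])
      (fun i j k => alt1 Ω _ _ _) (fun i j k => alt2 Ω _ _ _) (by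
        intro i j k hij hjk n1 n2
        rcases sorted_cases i j k hij hjk with ⟨rfl, rfl, rfl⟩ | ⟨rfl, rfl, rfl⟩ | ⟨hi, hk⟩
        · exact absurd rfl n1
        · exact absurd rfl n2
        · rw [hΩ]; exact model_sorted b α β m3 m4 i j k hi hk)
  have hA1 : Ω ![b 0, b 1, b 2] = 1 := by
    rw [hΩ, AlternatingMap.add_apply, m1, m4 _ 0 0 rfl (by decide), add_zero]
  have hA2 : Ω ![b 3, b 4, b 5] = 1 := by
    rw [hΩ, AlternatingMap.add_apply, m2, m3 _ 0 3 rfl (by decide), zero_add]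
  have ht : ε b * ε b * LinearMap.trace ℝ W (F ∘ₗ F) = 6 := by
    rw [trace_basis b, Finset.mul_sum]
    simp only [LinearMap.comp_apply, entry2 hF b, hp, hA1, hA2]
    simp only [Fin.sum_univ_six]
    simp (decide := true)
    norm_num
  have hc2 : 0 < ε b * ε b := mul_self_pos.2 hc
  by_contra hneg
  nlinarith

theorem forward (hdim : Module.finrank ℝ W = 6) (hε : ε ≠ 0)
    (hF : ∀ (θ : W →ₗ[ℝ] ℝ) (v : W),
      wedge (oneForm θ) (wedge (Ω.curryLeft v) Ω) = θ (F v) • ε)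
    (hpos : 0 < LinearMap.trace ℝ W (F ∘ₗ F)) :
    ∃ α β : AlternatingMap ℝ W ℝ (Fin 3),
        IsDecomposable α ∧ IsDecomposable β ∧ wedge α β ≠ 0 ∧ Ω = α + β := by
  obtain ⟨r, hr⟩ := sqF hdim hε hF
  have hr0 : 0 < r := by
    rw [hr, map_smul, LinearMap.trace_one, hdim, smul_eq_mul] at hpos
    push_cast at hpos
    linarith
  let μ := Real.sqrt r
  have hμ : μ ≠ 0 := (Real.sqrt_pos.2 hr0).ne'
  have hμ2 : μ * μ = r := Real.mul_self_sqrt hr0.le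
  obtain ⟨b, hb1, hb2⟩ := eigenbasis (F := F) hdim hμ (fun x => by
    rw [hμ2]; exact congrArg (fun f => f x) hr) (traceF hdim hε hF)
  have hc : ε b ≠ 0 := (AlternatingMap.map_basis_ne_zero_iff b ε).2 hε
  have hmix : ∀ i j k : Fin 6, i < 3 → 3 ≤ k → Ω ![b i, b j, b k] = 0 := by
    intro i j k hi hk
    rw [alt2, symF2 hdim hε hF (b i) (b k) (b j) hμ (hb1 i hi) (hb2 k hk), neg_zero]
  have hp := poly4 (A := fun i j k => Ω ![b i, b j, b k])
      (fun i j k => alt1 Ω _ _ _) (fun i j k => alt2 Ω _ _ _) (by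
        intro i j k hij hjk n1 n2
        rcases sorted_cases i j k hij hjk with ⟨rfl, rfl, rfl⟩ | ⟨rfl, rfl, rfl⟩ | ⟨hi, hk⟩
        · exact absurd rfl n1
        · exact absurd rfl n2
        · exact hmix i j k hi hk)
  have h00 := entry hF b 0 0
  rw [hp, hb1 0 (by decide)] at h00
  simp at h00
  have hst : Ω ![b 0, b 1, b 2] * Ω ![b 3, b 4, b 5] ≠ 0 := by
    rw [← h00]
    exact mul_ne_zero hc hμ
  obtain ⟨α, hα⟩ : ∃ α : AlternatingMap ℝ W ℝ (Fin 3), α =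
    wedge (oneForm (Ω ![b 0, b 1, b 2] • b.coord 0))
      (wedge (oneForm (b.coord 1)) (oneForm (b.coord 2))) := ⟨_, rfl⟩
  obtain ⟨β, hβ⟩ : ∃ β : AlternatingMap ℝ W ℝ (Fin 3), β =
    wedge (oneForm (Ω ![b 3, b 4, b 5] • b.coord 3))
      (wedge (oneForm (b.coord 4)) (oneForm (b.coord 5))) := ⟨_, rfl⟩
  obtain ⟨m1, m2, m3, m4⟩ := model b (fun i => b.coord i)
    (fun i j => by
      rw [Module.Basis.coord_apply, Module.Basis.repr_self, Finsupp.single_apply]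
      simp [eq_comm])
    (Ω ![b 0, b 1, b 2]) (Ω ![b 3, b 4, b 5]) α β hα hβ
  refine ⟨α, β, ⟨_, _, _, hα⟩, ⟨_, _, _, hβ⟩, ?_, ?_⟩
  rotate_left
  · apply eq_of_sorted b
    intro i j k hij hjk
    rcases sorted_cases i j k hij hjk with ⟨rfl, rfl, rfl⟩ | ⟨rfl, rfl, rfl⟩ | ⟨hi, hk⟩
    · rw [AlternatingMap.add_apply, m1, m4 _ 0 0 rfl (by decide), add_zero]
    · rw [AlternatingMap.add_apply, m2, m3 _ 0 3 rfl (by decide), zero_add]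
    · rw [hmix i j k hi hk]
      exact (model_sorted b _ _ m3 m4 i j k hi hk).symm
  · intro hw
    have hz : wedge α β (b : Fin (3 + 3) → W) = 0 := by rw [hw]; rfl
    rw [wedge_eq_single] at hz
    · have e1 : ∀ f : Fin 6 → W, (fun k : Fin 3 => f ((1 : Equiv.Perm (Fin (3 + 3)))
        (Fin.castAdd 3 k))) = ![f 0, f 1, f 2] := by
        intro f; ext k; fin_cases k <;> rfl
      have e2 : ∀ f : Fin 6 → W, (fun k : Fin 3 => f ((1 : Equiv.Perm (Fin (3 + 3)))
        (Fin.natAdd 3 k))) = ![f 3, f 4, f 5] := by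
        intro f; ext k; fin_cases k <;> rfl
      apply hst
      rw [wterm, e1, e2, m1, m2] at hz
      simpa using hz
    · rintro σ ⟨k, k', hk⟩
      rw [wterm, m3 _ k (Fin.natAdd 3 k') (by rw [hk]) (by simp [Fin.le_def])]
      simp
end main

/-- For `Ω ∈ Λ³W*` (W a 6-dimensional real vector space),
`λ(Ω) > 0` iff `Ω = α + β` with `α, β` real decomposable 3-forms and
`α ∧ β ≠ 0`.  Here `K` is characterized by `θ ∧ ι(v)Ω ∧ Ω = θ(K_Ω v) • ε`
and `λ(Ω) = (1/6) tr(K_Ω²)` (its sign is independent of the choice of ε). -/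
theorem stmt4 (W : Type*) [AddCommGroup W] [Module ℝ W] [FiniteDimensional ℝ W]
    (hdim : Module.finrank ℝ W = 6)
    (ε : AlternatingMap ℝ W ℝ (Fin 6)) (hε : ε ≠ 0)
    (K : AlternatingMap ℝ W ℝ (Fin 3) → W →ₗ[ℝ] W)
    (hK : ∀ (Ω : AlternatingMap ℝ W ℝ (Fin 3)) (θ : W →ₗ[ℝ] ℝ) (v : W),
      wedge (oneForm θ) (wedge (Ω.curryLeft v) Ω) = θ (K Ω v) • ε)
    (Ω : AlternatingMap ℝ W ℝ (Fin 3)) :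
    0 < (6 : ℝ)⁻¹ * LinearMap.trace ℝ W (K Ω ∘ₗ K Ω) ↔
      ∃ α β : AlternatingMap ℝ W ℝ (Fin 3),
        IsDecomposable α ∧ IsDecomposable β ∧ wedge α β ≠ 0 ∧ Ω = α + β := by

  have hs : 0 < (6 : ℝ)⁻¹ * LinearMap.trace ℝ W (K Ω ∘ₗ K Ω) ↔
      0 < LinearMap.trace ℝ W (K Ω ∘ₗ K Ω) := by
    constructor <;> intro h <;> linarith
  rw [hs]
  constructor
  · exact forward hdim hε (hK Ω)
  · rintro ⟨α, β, hα, hβ, hw, hΩ⟩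
    exact backward hdim hε (hK Ω) α β hα hβ hw hΩ
end
end
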